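/- arXiv:1102.3201 — 9 statements merged into one kernel-verified Lean document; each statement's English description precedes it below -/
import Mathlib

section
/- Let Δ ⊂ ℕ^d be a lower set and let ρ = (ρ_1,...,ρ_d) be a d-tuple of vectors in 𝔽^d. Then the subspace Q = span_𝔽 { ∏_{i=1}^d (ρ_i · x)^{α_i} : α ∈ Δ } of 𝔽[x_1,...,x_d] is D-invariant; that is, for every q ∈ Q and every 1 ≤ i ≤ d, the partial derivative ∂q/∂x_i belongs to Q. -/
open MvPolynomial

/-- A derivation that is constant on each `f i` maps `∏ i, f i ^ α i` to a linear combination of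
the products in which one exponent is lowered by one. -/
theorem Derivation.map_prod_pow_of_apply_eq_algebraMap {R A ι : Type*} [CommSemiring R]
    [CommSemiring A] [Algebra R A] [DecidableEq ι] (D : Derivation R A A) (s : Finset ι)
    (f : ι → A) (c : ι → R) (hf : ∀ i, D (f i) = algebraMap R A (c i)) (α : ι → ℕ) :
    D (∏ i ∈ s, f i ^ α i) =
      ∑ k ∈ s, (α k * c k : R) • ∏ i ∈ s, f i ^ (Function.update α k (α k - 1)) i := by
  induction s using Finset.induction_on with
  | empty => simp
  | insert a s ha ih =>
    rw [Finset.prod_insert ha, D.leibniz, ih, Finset.sum_insert ha, add_comm]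
    congr 1
    · have hprod : ∏ i ∈ s, f i ^ (Function.update α a (α a - 1)) i = ∏ i ∈ s, f i ^ α i :=
        Finset.prod_congr rfl fun i hi => by
          rw [Function.update_of_ne (ne_of_mem_of_not_mem hi ha)]
      rw [Finset.prod_insert ha, hprod, Function.update_self, D.leibniz_pow, hf]
      simp only [smul_eq_mul, nsmul_eq_mul, Algebra.smul_def (R := R), map_mul,
        _root_.map_natCast]
      ring
    · rw [Finset.smul_sum]
      refine Finset.sum_congr rfl fun k hk => ?_
      rw [Finset.prod_insert ha, Function.update_of_ne (ne_of_mem_of_not_mem hk ha).symm,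
        smul_eq_mul, mul_smul_comm]

/-- for a lower set `Δ ⊂ ℕ^d` and vectors `ρ_1, …, ρ_d ∈ 𝔽^d`, the span of
`{ ∏_i (ρ_i · x)^{α_i} : α ∈ Δ }` is D-invariant: it is closed under every `∂/∂x_i`. -/
theorem span_prod_linear_lowerSet_D_invariant {𝕜 : Type*} [RCLike 𝕜] {d : ℕ} (hd : 1 ≤ d)
    (Δ : Set (Fin d → ℕ))
    (hΔ : ∀ α ∈ Δ, ∀ β : Fin d → ℕ, (∀ i, β i ≤ α i) → β ∈ Δ)
    (ρ : Fin d → (Fin d → 𝕜)) :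
    ∀ q ∈ Submodule.span 𝕜
        {p : MvPolynomial (Fin d) 𝕜 | ∃ α ∈ Δ, p = ∏ i, (∑ j, C (ρ i j) * X j) ^ α i},
      ∀ i : Fin d,
        pderiv i q ∈ Submodule.span 𝕜
          {p : MvPolynomial (Fin d) 𝕜 | ∃ α ∈ Δ, p = ∏ i, (∑ j, C (ρ i j) * X j) ^ α i} := by
  intro q hq j
  induction hq using Submodule.span_induction with
  | mem p hp =>
    obtain ⟨α, hα, rfl⟩ := hp
    have hf (i : Fin d) : pderiv j (∑ k, C (ρ i k) * X k : MvPolynomial (Fin d) 𝕜) =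
        algebraMap 𝕜 (MvPolynomial (Fin d) 𝕜) (ρ i j) := by
      simp [pderiv_X, Pi.single_apply, algebraMap_eq]
    rw [Derivation.map_prod_pow_of_apply_eq_algebraMap _ _ _ _ hf]
    refine Submodule.sum_mem _ fun k _ => Submodule.smul_mem _ _ (Submodule.subset_span ?_)
    exact ⟨_, hΔ α hα _ (update_le_self_iff.2 (Nat.sub_le _ _)), rfl⟩
  | zero => simp
  | add p r _ _ hp hr => simpa using Submodule.add_mem _ hp hr
  | smul a p _ hp => simpa using Submodule.smul_mem _ a hp
end

section
/- The polynomials q_{n,0}, q_{n,1}, ..., q_{n,a_1} are 𝔽-linearly independent; consequently, the subspace Q = span_𝔽 { q_{n,m} : 0 ≤ m ≤ a_1 } has dimension a_1 + 1. -/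
open MvPolynomial

/-- The polynomial `q_{n,m}` from Section 4 of the paper:
`q_{n,m} = ∑_{τ(γ)=m} (∏_i ∏_j c_{i,j}^{γ_{i,j}} / γ_i!) x_1^{‖γ_1‖₁} ⋯ x_d^{‖γ_d‖₁}`,
where `τ(γ_1,…,γ_d) = ∑_{j=0}^n a_j ∑_{i=1}^d γ_{i,j}`.  (Since every `a_j ≥ 1`, any `γ`
with `τ(γ) = m` has all entries `≤ m`, so the sum may be taken over entries in
`{0,…,m}`.) -/
noncomputable def qpoly {𝕜 : Type*} [RCLike 𝕜] (d n : ℕ) (a : ℕ → ℕ) (c : Fin d → ℕ → 𝕜)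
    (m : ℕ) : MvPolynomial (Fin d) 𝕜 :=
  ∑ γ ∈ (Fintype.piFinset fun _ : Fin d =>
        Fintype.piFinset fun _ : Fin (n + 1) => Finset.range (m + 1)).filter
      (fun γ => ∑ j : Fin (n + 1), a j.1 * ∑ i, γ i j = m),
    ((∏ i, ∏ j, c i j.1 ^ γ i j) / ((∏ i, ∏ j, Nat.factorial (γ i j) : ℕ) : 𝕜)) •
      ∏ i, X i ^ (∑ j, γ i j)

theorem prod_X_pow_eq_monomial_equivFunOnFinite {σ R : Type*} [Fintype σ] [CommSemiring R]
    (e : σ → ℕ) :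
    (∏ i, X i ^ e i : MvPolynomial σ R) = monomial (Finsupp.equivFunOnFinite.symm e) 1 := by
  rw [monomial_eq, Finsupp.prod_fintype _ _ (by simp)]
  simp

/-- Weights strictly decreasing on `[1, n]` and with last value at least `2` are all at least `2`. -/
theorem two_le_of_decreasing {n : ℕ} {a : ℕ → ℕ}
    (hadec : ∀ j, 1 ≤ j → j < n → a (j + 1) < a j) (han : 2 ≤ a n) {j : ℕ} (hj : 1 ≤ j)
    (hjn : j ≤ n) : 2 ≤ a j := by
  induction hjn using Nat.decreasingInduction with
  | self => exact han
  | of_succ k hk ih =>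
    have := hadec k hj hk
    have := ih (by omega)
    omega

/-- With positive weights, the total weight is at least any single row sum. -/
theorem le_weight_of_row_sum_eq {d n m : ℕ} {a : ℕ → ℕ} (ha : ∀ j : Fin (n + 1), 1 ≤ a j)
    {γ : Fin d → Fin (n + 1) → ℕ} {i₀ : Fin d} (hγ : ∑ j, γ i₀ j = m) :
    m ≤ ∑ j : Fin (n + 1), a j * ∑ i, γ i j := by
  rw [← hγ]
  refine Finset.sum_le_sum fun j _ => ?_
  calc γ i₀ j ≤ ∑ i, γ i j :=
        Finset.single_le_sum (f := fun i => γ i j) (fun _ _ => Nat.zero_le _) (Finset.mem_univ i₀)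
    _ ≤ a j * ∑ i, γ i j := Nat.le_mul_of_pos_left _ (ha j)

/-- If only row `i₀` has nonzero sum `m` and the total weight is also `m`, then only the entry
`(i₀, 0)` is nonzero. -/
theorem eq_single_of_weight_eq {d n m : ℕ} {a : ℕ → ℕ} (ha0 : a 0 = 1)
    (ha : ∀ j : Fin (n + 1), j ≠ 0 → 2 ≤ a j) {γ : Fin d → Fin (n + 1) → ℕ} {i₀ : Fin d}
    (hγ : ∀ i, ∑ j, γ i j = (Pi.single i₀ m : Fin d → ℕ) i)
    (hτ : ∑ j : Fin (n + 1), a j * ∑ i, γ i j = m) :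
    γ = Pi.single i₀ (Pi.single 0 m) := by
  have htot : ∑ j, ∑ i, γ i j = m := by
    rw [Finset.sum_comm]
    simp [hγ]
  have hle : ∀ j ∈ Finset.univ, ∑ i, γ i j ≤ a j.1 * ∑ i, γ i j := by
    intro j _
    refine Nat.le_mul_of_pos_left _ ?_
    by_cases hj : j = 0
    · simp [hj, ha0]
    · have := ha j hj
      omega
  have heq := (Finset.sum_eq_sum_iff_of_le hle).mp (htot.trans hτ.symm)
  have hzero : ∀ i j, j ≠ 0 → γ i j = 0 := by
    intro i j hj
    have h1 := heq j (Finset.mem_univ j)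
    have h2 := ha j hj
    have h3 : ∑ i, γ i j = 0 := by nlinarith
    exact (Finset.sum_eq_zero_iff.mp h3) i (Finset.mem_univ i)
  have hcol : ∀ i, γ i 0 = (Pi.single i₀ m : Fin d → ℕ) i := by
    intro i
    rw [← hγ i]
    exact (Finset.sum_eq_single 0 (fun j _ hj => hzero i j hj) (by simp)).symm
  ext i j
  by_cases hj : j = 0
  · subst hj
    rw [hcol]
    by_cases hi : i = i₀
    · subst hi; simp
    · simp [hi]
  · rw [hzero i j hj]
    by_cases hi : i = i₀
    · subst hi; simp [hj]
    · simp [hi]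

theorem coeff_qpoly {𝕜 : Type*} [RCLike 𝕜] (d n : ℕ) (a : ℕ → ℕ) (c : Fin d → ℕ → 𝕜)
    (k : ℕ) (s : Fin d →₀ ℕ) :
    coeff s (qpoly d n a c k) =
      ∑ γ ∈ (Fintype.piFinset fun _ : Fin d =>
          Fintype.piFinset fun _ : Fin (n + 1) => Finset.range (k + 1)).filter
        (fun γ => ∑ j : Fin (n + 1), a j.1 * ∑ i, γ i j = k),
      if ∀ i, ∑ j, γ i j = s i then
        (∏ i, ∏ j, c i j.1 ^ γ i j) / ((∏ i, ∏ j, Nat.factorial (γ i j) : ℕ) : 𝕜) else 0 := by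
  classical
  rw [qpoly, coeff_sum]
  refine Finset.sum_congr rfl fun γ _ => ?_
  rw [coeff_smul, prod_X_pow_eq_monomial_equivFunOnFinite, coeff_monomial]
  simp [Finsupp.ext_iff]

theorem coeff_single_qpoly_of_lt {𝕜 : Type*} [RCLike 𝕜] {d n : ℕ} {a : ℕ → ℕ}
    (c : Fin d → ℕ → 𝕜) (ha : ∀ j : Fin (n + 1), 1 ≤ a j) (i₀ : Fin d) {k m : ℕ} (hkm : k < m) :
    coeff (Finsupp.single i₀ m) (qpoly d n a c k) = 0 := by
  rw [coeff_qpoly]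
  refine Finset.sum_eq_zero fun γ hγ => if_neg fun h => ?_
  have := le_weight_of_row_sum_eq ha (by simpa using h i₀)
  rw [(Finset.mem_filter.mp hγ).2] at this
  omega

theorem coeff_single_qpoly_self {𝕜 : Type*} [RCLike 𝕜] {d n : ℕ} {a : ℕ → ℕ}
    (c : Fin d → ℕ → 𝕜) (ha0 : a 0 = 1) (ha : ∀ j : Fin (n + 1), j ≠ 0 → 2 ≤ a j)
    (i₀ : Fin d) (m : ℕ) :
    coeff (Finsupp.single i₀ m) (qpoly d n a c m) = c i₀ 0 ^ m / (m.factorial : 𝕜) := by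
  rw [coeff_qpoly, Finset.sum_eq_single (Pi.single i₀ (Pi.single 0 m))]
  · have hrow : ∀ i, ∑ j, (Pi.single i₀ (Pi.single 0 m) : Fin d → Fin (n + 1) → ℕ) i j =
        Finsupp.single i₀ m i := by
      intro i
      by_cases hi : i = i₀
      · subst hi; simp
      · simp [hi]
    rw [if_pos hrow, Finset.prod_eq_single i₀, Finset.prod_eq_single 0,
      Finset.prod_eq_single i₀, Finset.prod_eq_single 0] <;> simp +contextual
  · intro γ hγ hne
    refine if_neg fun h => hne ?_
    refine eq_single_of_weight_eq ha0 ha (fun i => ?_) (Finset.mem_filter.mp hγ).2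
    rw [h i, Finsupp.single_eq_pi_single]
  · intro h
    refine (h ?_).elim
    simp only [Finset.mem_filter, Fintype.mem_piFinset, Finset.mem_range]
    refine ⟨fun i j => ?_, ?_⟩
    · by_cases hi : i = i₀
      · subst hi
        by_cases hj : j = 0
        · subst hj; simp
        · simp [hj]
      · simp [hi]
    · rw [Finset.sum_eq_single 0]
      · rw [Finset.sum_eq_single i₀] <;> simp +contextual [ha0]
      · intro j _ hj
        rw [Finset.sum_eq_zero, mul_zero]
        intro i _
        by_cases hi : i = i₀
        · subst hi; simp [hj]
        · simp [hi]
      · simp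

/-- A finite family is linearly independent as soon as it is triangular with nonzero diagonal
with respect to some family of linear functionals. -/
theorem linearIndependent_of_triangular {K V ι : Type*} [Field K] [AddCommGroup V] [Module K V]
    [Fintype ι] [LinearOrder ι] (v : ι → V) (l : ι → V →ₗ[K] K)
    (hlt : ∀ k m, k < m → l m (v k) = 0) (hself : ∀ m, l m (v m) ≠ 0) :
    LinearIndependent K v := by
  rw [Fintype.linearIndependent_iff]
  intro g hg m
  induction m using WellFoundedGT.induction with
  | ind m ih =>
    have h := congrArg (l m) hg
    rw [map_sum, Finset.sum_eq_single m, map_zero, map_smul, smul_eq_mul] at h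
    · exact (mul_eq_zero.mp h).resolve_right (hself m)
    · intro k _ hk
      rcases lt_or_gt_of_ne hk with hk | hk
      · rw [map_smul, hlt k m hk, smul_zero]
      · rw [ih k hk, zero_smul, map_zero]
    · simp

/-- the polynomials `q_{n,0}, …, q_{n,a_1}` are `𝔽`-linearly independent, so
`Q = span{q_{n,m} : 0 ≤ m ≤ a_1}` has dimension `a_1 + 1`. -/
theorem qpoly_linearIndependent_and_finrank {𝕜 : Type*} [RCLike 𝕜] (d n : ℕ)
    (hd : 1 ≤ d) (hn : 1 ≤ n) (a : ℕ → ℕ) (c : Fin d → ℕ → 𝕜)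
    (ha0 : a 0 = 1) (hadec : ∀ j, 1 ≤ j → j < n → a (j + 1) < a j) (han : 2 ≤ a n)
    (hc : ∃ i : Fin d, c i 0 ≠ 0) :
    LinearIndependent 𝕜 (fun m : Fin (a 1 + 1) => qpoly d n a c m.1) ∧
      Module.finrank 𝕜
        (Submodule.span 𝕜 (Set.range fun m : Fin (a 1 + 1) => qpoly d n a c m.1))
        = a 1 + 1 := by
  obtain ⟨i₀, hi₀⟩ := hc
  have ha : ∀ j : Fin (n + 1), j ≠ 0 → 2 ≤ a j := fun j hj =>
    two_le_of_decreasing hadec han (Nat.one_le_iff_ne_zero.mpr (Fin.val_ne_zero_iff.mpr hj))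
      (Nat.lt_succ_iff.mp j.2)
  have ha1 : ∀ j : Fin (n + 1), 1 ≤ a j := by
    intro j
    by_cases hj : j = 0
    · simp [hj, ha0]
    · exact one_le_two.trans (ha j hj)
  have hli : LinearIndependent 𝕜 (fun m : Fin (a 1 + 1) => qpoly d n a c m.1) := by
    refine linearIndependent_of_triangular _ (fun m => lcoeff 𝕜 (Finsupp.single i₀ m.1)) ?_ ?_
    · intro k m hkm
      exact coeff_single_qpoly_of_lt c ha1 i₀ hkm
    · intro m
      rw [lcoeff_apply, coeff_single_qpoly_self c ha0 ha]
      exact div_ne_zero (pow_ne_zero _ hi₀) (Nat.cast_ne_zero.mpr (Nat.factorial_ne_zero _))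
  refine ⟨hli, ?_⟩
  rw [finrank_span_eq_card hli, Fintype.card_fin]
end

section
/- For every m with 0 ≤ m < a_n, one has q_{n,m} = (1/m!) · (c_{1,0} x_1 + c_{2,0} x_2 + ⋯ + c_{d,0} x_d)^m. -/
open MvPolynomial

theorem le_of_forall_succ_lt {n : ℕ} {a : ℕ → ℕ}
    (ha : ∀ j, 1 ≤ j → j < n → a (j + 1) < a j) {j : ℕ} (hj : 1 ≤ j) (hjn : j ≤ n) :
    a n ≤ a j := by
  induction n, hjn using Nat.le_induction with
  | base => rfl
  | succ k hk ih =>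
    exact (ha k (hj.trans hk) k.lt_succ_self).le.trans
      (ih fun i hi hik => ha i hi (hik.trans k.lt_succ_self))

/-- The family of exponents supported on the zeroth column, where it equals `k`. -/
def zerothColumn {d : ℕ} (n : ℕ) (k : Fin d → ℕ) : Fin d → Fin (n + 1) → ℕ :=
  fun i => Fin.cons (k i) 0

theorem filter_weight_eq_image_zerothColumn {d n m : ℕ} {a : ℕ → ℕ} (ha0 : a 0 = 1)
    (ha : ∀ j, 1 ≤ j → j ≤ n → m < a j) :
    (Fintype.piFinset fun _ : Fin d =>
        Fintype.piFinset fun _ : Fin (n + 1) => Finset.range (m + 1)).filter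
      (fun γ => ∑ j : Fin (n + 1), a j.1 * ∑ i, γ i j = m)
      = (Finset.piAntidiag Finset.univ m).image (zerothColumn n) := by
  ext γ
  simp only [Finset.mem_filter, Fintype.mem_piFinset, Finset.mem_range, Finset.mem_image,
    Finset.mem_piAntidiag, Finset.mem_univ, implies_true, and_true]
  constructor
  · rintro ⟨-, hγ⟩
    have hcol (j : Fin n) : ∑ i, γ i j.succ = 0 := by
      by_contra h
      have hle : a j.succ.1 * ∑ i, γ i j.succ ≤ m :=
        hγ ▸ Finset.single_le_sum (f := fun j : Fin (n + 1) => a j.1 * ∑ i, γ i j)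
          (fun _ _ => Nat.zero_le _) (Finset.mem_univ j.succ)
      have hlt := ha j.succ.1 (by simp) (by simp)
      have := Nat.le_mul_of_pos_right (a j.succ.1) (Nat.pos_of_ne_zero h)
      omega
    refine ⟨fun i => γ i 0, ?_, ?_⟩
    · simpa [Fin.sum_univ_succ, hcol, ha0] using hγ
    · ext i j
      refine Fin.cases rfl (fun j => ?_) j
      simpa [zerothColumn] using
        (Finset.sum_eq_zero_iff.mp (hcol j) i (Finset.mem_univ i)).symm
  · rintro ⟨k, hk, rfl⟩
    refine ⟨fun i j => ?_, ?_⟩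
    · refine Fin.cases ?_ (fun j => ?_) j
      · have := Finset.single_le_sum (f := k) (fun _ _ => Nat.zero_le _) (Finset.mem_univ i)
        simpa [zerothColumn, Nat.lt_succ_iff, hk] using this
      · simp [zerothColumn]
    · simpa [zerothColumn, Fin.sum_univ_succ, ha0] using hk

theorem zerothColumn_injective {d : ℕ} (n : ℕ) :
    Function.Injective (zerothColumn n : (Fin d → ℕ) → Fin d → Fin (n + 1) → ℕ) := by
  intro k l h
  ext i
  simpa [zerothColumn] using congrFun (congrFun h i) 0

/-- for `0 ≤ m < a_n`,
`q_{n,m} = (1/m!) (c_{1,0} x_1 + ⋯ + c_{d,0} x_d)^m`. -/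
theorem qpoly_eq_linear_pow_of_lt {𝕜 : Type*} [RCLike 𝕜] (d n : ℕ)
    (hd : 1 ≤ d) (hn : 1 ≤ n) (a : ℕ → ℕ) (c : Fin d → ℕ → 𝕜)
    (ha0 : a 0 = 1) (hadec : ∀ j, 1 ≤ j → j < n → a (j + 1) < a j) (han : 2 ≤ a n)
    (hc : ∃ i : Fin d, c i 0 ≠ 0)
    (m : ℕ) (hm : m < a n) :
    qpoly d n a c m
      = ((m.factorial : 𝕜))⁻¹ • (∑ i, C (c i 0) * X i) ^ m := by
  have ha (j : ℕ) (hj : 1 ≤ j) (hjn : j ≤ n) : m < a j :=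
    hm.trans_le (le_of_forall_succ_lt hadec hj hjn)
  rw [qpoly, filter_weight_eq_image_zerothColumn ha0 ha,
    Finset.sum_image (zerothColumn_injective n).injOn, Finset.sum_pow_eq_sum_piAntidiag,
    Finset.smul_sum]
  refine Finset.sum_congr rfl fun k hk => ?_
  have hkm : ∑ i, k i = m := (Finset.mem_piAntidiag.mp hk).1
  have hspec : ((∏ i, Nat.factorial (k i) : ℕ) : 𝕜) * Nat.multinomial Finset.univ k
      = m.factorial := by
    rw [← hkm]
    exact_mod_cast Nat.multinomial_spec Finset.univ k
  have hprod : ((∏ i, Nat.factorial (k i) : ℕ) : 𝕜) ≠ 0 := by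
    exact_mod_cast (Nat.prod_factorial_pos Finset.univ k).ne'
  have hm0 : (m.factorial : 𝕜) ≠ 0 := by exact_mod_cast m.factorial_ne_zero
  have hcoeff : (∏ i, c i 0 ^ k i) / ((∏ i, Nat.factorial (k i) : ℕ) : 𝕜)
      = (m.factorial : 𝕜)⁻¹ * (Nat.multinomial Finset.univ k * ∏ i, c i 0 ^ k i) := by
    rw [div_eq_iff hprod]
    field_simp
    rw [← hspec]
    ring
  simp only [zerothColumn, Fin.prod_univ_succ, Fin.sum_univ_succ, Fin.cons_zero, Fin.cons_succ,
    Pi.zero_apply, pow_zero, Nat.factorial_zero, Finset.prod_const_one, Finset.sum_const_zero,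
    mul_one, add_zero, Fin.val_zero]
  rw [hcoeff]
  simp only [smul_eq_C_mul, mul_pow, Finset.prod_mul_distrib, map_mul, map_prod, map_pow,
    map_natCast]
  ring
end

section
/- For every m with 1 ≤ m < a_n and every i ∈ {1,...,d}, one has ∂q_{n,m}/∂x_i = c_{i,0} · q_{n,m-1}. -/
open MvPolynomial

/-- If every weight other than the first exceeds `m`, the polynomial `q_{n,m}` is the
`m`-th term of the exponential series of the linear form `∑ i, c_{i,0} x_i`. -/
theorem qpoly_eq_linearForm_pow {𝕜 : Type*} [RCLike 𝕜] (d n : ℕ) (a : ℕ → ℕ)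
    (c : Fin d → ℕ → 𝕜) (ha0 : a 0 = 1) (m : ℕ) (ha : ∀ j, 1 ≤ j → j ≤ n → m < a j) :
    qpoly d n a c m = C ((m.factorial : 𝕜)⁻¹) * (∑ i, C (c i 0) * X i) ^ m := by
  have entry_eq_zero (γ : Fin d → Fin (n + 1) → ℕ)
      (h : ∑ j : Fin (n + 1), a j.1 * ∑ i, γ i j = m) (i : Fin d) (j : Fin n) :
      γ i j.succ = 0 := by
    by_contra hne
    have h1 : a j.succ.1 * ∑ i, γ i j.succ ≤ m := h ▸ Finset.single_le_sum
      (f := fun j : Fin (n + 1) => a j.1 * ∑ i, γ i j) (fun _ _ => Nat.zero_le _)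
      (Finset.mem_univ j.succ)
    have h2 : γ i j.succ ≤ ∑ i, γ i j.succ := Finset.single_le_sum
      (f := fun i => γ i j.succ) (fun _ _ => Nat.zero_le _) (Finset.mem_univ i)
    have h3 := ha j.succ.1 (by simp) (by simp)
    have h4 : a j.succ.1 * 1 ≤ a j.succ.1 * ∑ i, γ i j.succ :=
      Nat.mul_le_mul_left _ (by omega)
    omega
  rw [Finset.sum_pow_eq_sum_piAntidiag, Finset.mul_sum, qpoly]
  refine Finset.sum_nbij' (fun γ i => γ i 0) (fun k i => Fin.cons (k i) 0) ?_ ?_ ?_ ?_ ?_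
  · intro γ hγ
    have h := (Finset.mem_filter.1 hγ).2
    have hz := entry_eq_zero γ h
    simpa [Fin.sum_univ_succ, hz, ha0] using h
  · intro k hk
    have h : ∑ i, k i = m := by simpa using hk
    have hle (i : Fin d) : k i ≤ m := h ▸ Finset.single_le_sum
      (fun _ _ => Nat.zero_le _) (Finset.mem_univ i)
    simp only [Finset.mem_filter, Fintype.mem_piFinset, Finset.mem_range]
    refine ⟨fun i j => ?_, ?_⟩
    · refine Fin.cases ?_ (fun j => ?_) j
      · simpa [Nat.lt_succ_iff] using hle i
      · simp
    · simpa [Fin.sum_univ_succ, ha0] using h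
  · intro γ hγ
    have hz := entry_eq_zero γ (Finset.mem_filter.1 hγ).2
    funext i j
    refine Fin.cases ?_ (fun j => ?_) j
    · simp
    · simp [hz]
  · intro k _
    simp
  · intro γ hγ
    have h := (Finset.mem_filter.1 hγ).2
    have hz := entry_eq_zero γ h
    have hsum : ∑ i, γ i 0 = m := by simpa [Fin.sum_univ_succ, hz, ha0] using h
    have hmult : (∏ i, ((γ i 0).factorial : 𝕜)) *
        (Nat.multinomial Finset.univ fun i => γ i 0 : ℕ) = m.factorial := by
      have := Nat.multinomial_spec Finset.univ fun i => γ i 0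
      rw [hsum] at this
      exact_mod_cast this
    have hprod : (∏ i, ((γ i 0).factorial : 𝕜)) ≠ 0 :=
      Finset.prod_ne_zero_iff.2 fun i _ => Nat.cast_ne_zero.2 (Nat.factorial_ne_zero _)
    have hfac : (m.factorial : 𝕜) ≠ 0 := Nat.cast_ne_zero.2 (Nat.factorial_ne_zero _)
    have hcoeff : (∏ i, c i 0 ^ γ i 0) / ∏ i, ((γ i 0).factorial : 𝕜) =
        (m.factorial : 𝕜)⁻¹ * (Nat.multinomial Finset.univ fun i => γ i 0 : ℕ) *
          ∏ i, c i 0 ^ γ i 0 := by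
      rw [div_eq_iff hprod]
      field_simp
      rw [← hmult]
      ring
    simp only [Fin.prod_univ_succ, Fin.sum_univ_succ, hz, Fin.val_zero, pow_zero,
      Nat.factorial_zero, Finset.prod_const_one, mul_one, Finset.sum_const_zero, add_zero,
      Nat.cast_prod, hcoeff, smul_eq_C_mul, mul_pow, Finset.prod_mul_distrib, map_mul,
      map_natCast, map_prod, map_pow]
    ring

/-- for `1 ≤ m < a_n` and every `i`,
`∂q_{n,m}/∂x_i = c_{i,0} q_{n,m-1}`. -/
theorem pderiv_qpoly_of_lt {𝕜 : Type*} [RCLike 𝕜] (d n : ℕ)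
    (hd : 1 ≤ d) (hn : 1 ≤ n) (a : ℕ → ℕ) (c : Fin d → ℕ → 𝕜)
    (ha0 : a 0 = 1) (hadec : ∀ j, 1 ≤ j → j < n → a (j + 1) < a j) (han : 2 ≤ a n)
    (hc : ∃ i : Fin d, c i 0 ≠ 0)
    (m : ℕ) (hm1 : 1 ≤ m) (hm2 : m < a n) (i : Fin d) :
    pderiv i (qpoly d n a c m) = C (c i 0) * qpoly d n a c (m - 1) := by
  have hn_le (j : ℕ) (hjn : j ≤ n) : 1 ≤ j → a n ≤ a j := by
    induction hjn using Nat.decreasingInduction with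
    | self => exact fun _ => le_rfl
    | of_succ k hk ih => exact fun h1 => (ih (by omega)).trans (hadec k h1 hk).le
  have ha (j : ℕ) (h1 : 1 ≤ j) (hj : j ≤ n) : m < a j := hm2.trans_le (hn_le j hj h1)
  obtain ⟨m, rfl⟩ := Nat.exists_eq_add_of_le' hm1
  rw [Nat.add_sub_cancel, qpoly_eq_linearForm_pow d n a c ha0 (m + 1) ha,
    qpoly_eq_linearForm_pow d n a c ha0 m fun j h1 hj => (Nat.lt_succ_self m).trans (ha j h1 hj)]
  have hlin : pderiv i (∑ k, C (c k 0) * X k) = C (c i 0) := by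
    simp [pderiv_X, Pi.single_apply]
  have hfac : C ((m + 1).factorial : 𝕜)⁻¹ * ((m + 1 : ℕ) : MvPolynomial (Fin d) 𝕜) =
      C (m.factorial : 𝕜)⁻¹ := by
    rw [← map_natCast C, ← C_mul, Nat.factorial_succ]
    congr 1
    have h1 : ((m + 1 : ℕ) : 𝕜) ≠ 0 := Nat.cast_ne_zero.2 (Nat.succ_ne_zero m)
    rw [Nat.cast_mul, mul_inv_rev, inv_mul_cancel_right₀ h1]
  rw [pderiv_C_mul, pderiv_pow, hlin, Nat.add_sub_cancel, ← hfac]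
  ring
end

section
/- For every m with a_n ≤ m ≤ a_1 and every i ∈ {1,...,d}, one has ∂q_{n,m}/∂x_i = c_{i,0} · q_{n,m-1} + Σ_{j=s}^{n} c_{i,j} · q_{n,m-a_j}, where s is the minimal integer in {1,...,n} such that m - a_s ≥ 0. -/
open MvPolynomial

/-- The monomial `c ^ k / k! * x_i ^ k`, i.e. the `k`-th term of `exp (c * x_i)`. -/
noncomputable def expTerm {σ 𝕜 : Type*} [Field 𝕜] (c : 𝕜) (i : σ) (k : ℕ) :
    MvPolynomial σ 𝕜 :=
  C (c ^ k / (k.factorial : 𝕜)) * X i ^ k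

lemma pderiv_expTerm_zero {σ 𝕜 : Type*} [Field 𝕜] (c : 𝕜) (i l : σ) :
    pderiv i (expTerm c l 0) = 0 := by
  simp [expTerm]

lemma pderiv_expTerm_of_ne {σ 𝕜 : Type*} [Field 𝕜] (c : 𝕜) {i l : σ} (h : l ≠ i) (k : ℕ) :
    pderiv i (expTerm c l k) = 0 := by
  simp [expTerm, Derivation.leibniz_pow, pderiv_X_of_ne h]

lemma pderiv_expTerm_succ {σ 𝕜 : Type*} [Field 𝕜] [CharZero 𝕜] (c : 𝕜) (i : σ) (k : ℕ) :
    pderiv i (expTerm c i (k + 1)) = C c * expTerm c i k := by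
  have h : c ^ (k + 1) / ((k + 1).factorial : 𝕜) * ((k + 1 : ℕ) : 𝕜)
      = c * (c ^ k / (k.factorial : 𝕜)) := by
    have h1 : (k.factorial : 𝕜) ≠ 0 := by exact_mod_cast k.factorial_ne_zero
    have h2 : ((k + 1 : ℕ) : 𝕜) ≠ 0 := by exact_mod_cast k.succ_ne_zero
    rw [Nat.factorial_succ, Nat.cast_mul]
    field_simp
    ring
  have h' := congrArg (C (σ := σ)) h
  simp only [map_mul, map_natCast] at h'
  rw [expTerm, expTerm, pderiv_C_mul, pderiv_pow, pderiv_X_self, mul_one, Nat.add_sub_cancel,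
    ← mul_assoc, h', mul_assoc]

/-- The summand of `qpoly` indexed by `γ`, as a product over all pairs `(i, j)`. -/
noncomputable def qterm {σ ι 𝕜 : Type*} [Fintype σ] [Fintype ι] [Field 𝕜] (c : σ → ι → 𝕜)
    (γ : σ → ι → ℕ) : MvPolynomial σ 𝕜 :=
  ∏ p : σ × ι, expTerm (c p.1 p.2) p.1 (γ p.1 p.2)

lemma smul_prod_eq_qterm {σ ι 𝕜 : Type*} [Fintype σ] [Fintype ι] [Field 𝕜] (c : σ → ι → 𝕜)
    (γ : σ → ι → ℕ) :
    ((∏ i, ∏ j, c i j ^ γ i j) / ((∏ i, ∏ j, Nat.factorial (γ i j) : ℕ) : 𝕜)) •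
      (∏ i, X i ^ (∑ j, γ i j) : MvPolynomial σ 𝕜) = qterm c γ := by
  simp only [qterm, expTerm, Fintype.prod_prod_type, Finset.prod_mul_distrib, ← map_prod,
    Finset.prod_div_distrib, Finset.prod_pow_eq_pow_sum, Nat.cast_prod, smul_eq_C_mul]

lemma Derivation.map_finset_prod {R A ι : Type*} [CommSemiring R] [CommSemiring A] [Algebra R A]
    [DecidableEq ι] (D : Derivation R A A) (t : Finset ι) (f : ι → A) :
    D (∏ p ∈ t, f p) = ∑ p ∈ t, (∏ q ∈ t.erase p, f q) * D (f p) := by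
  induction t using Finset.induction_on with
  | empty => simp
  | insert b t hb ih =>
    rw [Finset.prod_insert hb, Derivation.leibniz, ih, Finset.sum_insert hb,
      Finset.erase_insert hb, smul_eq_mul, smul_eq_mul, Finset.mul_sum, add_comm]
    congr 1
    refine Finset.sum_congr rfl fun p hp => ?_
    have hpb : b ≠ p := fun h => hb (h ▸ hp)
    rw [Finset.erase_insert_of_ne hpb,
      Finset.prod_insert (fun h => hb (Finset.mem_of_mem_erase h)), mul_assoc]

/-- The tuple with entry `1` at `(i, j)` and `0` elsewhere. -/
def unitTuple {σ ι : Type*} [DecidableEq σ] [DecidableEq ι] (i : σ) (j : ι) : σ → ι → ℕ :=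
  Pi.single i (Pi.single j 1)

lemma unitTuple_apply {σ ι : Type*} [DecidableEq σ] [DecidableEq ι] (i k : σ) (j l : ι) :
    unitTuple i j k l = if k = i ∧ l = j then 1 else 0 := by
  by_cases hk : k = i
  · subst hk
    by_cases hl : l = j <;> simp [unitTuple, hl]
  · simp [unitTuple, hk]

lemma sub_unitTuple_add {σ ι : Type*} [DecidableEq σ] [DecidableEq ι] {i : σ} {j : ι}
    {γ : σ → ι → ℕ} (h : γ i j ≠ 0) : γ - unitTuple i j + unitTuple i j = γ := by
  funext k l
  simp only [Pi.add_apply, Pi.sub_apply, unitTuple_apply]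
  split_ifs with hkl
  · obtain ⟨rfl, rfl⟩ := hkl
    omega
  · simp

lemma pderiv_qterm {σ ι 𝕜 : Type*} [Fintype σ] [Fintype ι] [DecidableEq σ] [DecidableEq ι]
    [Field 𝕜] [CharZero 𝕜] (c : σ → ι → 𝕜) (γ : σ → ι → ℕ) (i : σ) :
    pderiv i (qterm c γ)
      = ∑ j, if γ i j = 0 then 0 else C (c i j) * qterm c (γ - unitTuple i j) := by
  rw [qterm, Derivation.map_finset_prod, Fintype.sum_prod_type, Finset.sum_eq_single i]
  · refine Finset.sum_congr rfl fun j _ => ?_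
    dsimp only
    split_ifs with h
    · rw [h, pderiv_expTerm_zero, mul_zero]
    · obtain ⟨δ, rfl⟩ : ∃ δ, γ = δ + unitTuple i j := ⟨_, (sub_unitTuple_add h).symm⟩
      rw [add_tsub_cancel_right, qterm, ← Finset.prod_erase_mul _ _ (Finset.mem_univ (i, j))]
      have hij : (δ + unitTuple i j) i j = δ i j + 1 := by simp [unitTuple_apply]
      rw [hij, pderiv_expTerm_succ, mul_left_comm]
      congr 2
      refine Finset.prod_congr rfl fun p hp => ?_
      have hne : ¬(p.1 = i ∧ p.2 = j) := fun h => (Finset.mem_erase.1 hp).1 (Prod.ext h.1 h.2)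
      simp [unitTuple_apply, hne]
  · intro k _ hk
    exact Finset.sum_eq_zero fun j _ => by rw [pderiv_expTerm_of_ne _ hk, mul_zero]
  · simp

/-- The weight `τ` of a tuple. -/
def tupleWeight {σ ι : Type*} [Fintype σ] [Fintype ι] (w : ι → ℕ) (γ : σ → ι → ℕ) : ℕ :=
  ∑ j, w j * ∑ i, γ i j

lemma tupleWeight_add_unitTuple {σ ι : Type*} [Fintype σ] [Fintype ι] [DecidableEq σ]
    [DecidableEq ι] (w : ι → ℕ) (γ : σ → ι → ℕ) (i : σ) (j : ι) :
    tupleWeight w (γ + unitTuple i j) = tupleWeight w γ + w j := by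
  simp [tupleWeight, Finset.sum_add_distrib, mul_add, unitTuple_apply, ite_and]

lemma le_tupleWeight {σ ι : Type*} [Fintype σ] [Fintype ι] {w : ι → ℕ} (hw : ∀ j, 1 ≤ w j)
    (γ : σ → ι → ℕ) (i : σ) (j : ι) : γ i j ≤ tupleWeight w γ :=
  calc γ i j ≤ ∑ i, γ i j :=
        Finset.single_le_sum (f := fun i => γ i j) (fun _ _ => Nat.zero_le _) (Finset.mem_univ i)
    _ ≤ w j * ∑ i, γ i j := Nat.le_mul_of_pos_left _ (hw j)
    _ ≤ tupleWeight w γ :=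
        Finset.single_le_sum (f := fun j => w j * ∑ i, γ i j) (fun _ _ => Nat.zero_le _)
          (Finset.mem_univ j)

/-- The tuples of weight `m`. -/
def tuplesOfWeight (σ : Type*) {ι : Type*} [Fintype σ] [Fintype ι] [DecidableEq σ]
    [DecidableEq ι] (w : ι → ℕ) (m : ℕ) : Finset (σ → ι → ℕ) :=
  (Fintype.piFinset fun _ : σ => Fintype.piFinset fun _ : ι => Finset.range (m + 1)).filter
    (fun γ => tupleWeight w γ = m)

lemma mem_tuplesOfWeight {σ ι : Type*} [Fintype σ] [Fintype ι] [DecidableEq σ]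
    [DecidableEq ι] {w : ι → ℕ} (hw : ∀ j, 1 ≤ w j) {m : ℕ} {γ : σ → ι → ℕ} :
    γ ∈ tuplesOfWeight σ w m ↔ tupleWeight w γ = m := by
  simp only [tuplesOfWeight, Finset.mem_filter, Fintype.mem_piFinset, Finset.mem_range,
    and_iff_right_iff_imp]
  rintro rfl i j
  exact Nat.lt_succ_of_le (le_tupleWeight hw γ i j)

lemma sum_tuplesOfWeight_sub_unitTuple {σ ι M : Type*} [Fintype σ] [Fintype ι] [DecidableEq σ]
    [DecidableEq ι] [AddCommMonoid M] {w : ι → ℕ} (hw : ∀ j, 1 ≤ w j) (m : ℕ) (i : σ) (j : ι)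
    (f : (σ → ι → ℕ) → M) :
    (∑ γ ∈ tuplesOfWeight σ w m, if γ i j = 0 then 0 else f (γ - unitTuple i j))
      = if w j ≤ m then ∑ γ ∈ tuplesOfWeight σ w (m - w j), f γ else 0 := by
  split_ifs with h
  · rw [← Finset.sum_filter_add_sum_filter_not _ (fun γ => γ i j = 0),
      Finset.sum_eq_zero fun γ hγ => if_pos (Finset.mem_filter.1 hγ).2, zero_add]
    refine Finset.sum_nbij' (· - unitTuple i j) (· + unitTuple i j) ?_ ?_ ?_ ?_ ?_
    · intro γ hγ
      rw [Finset.mem_filter, mem_tuplesOfWeight hw] at hγ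
      rw [mem_tuplesOfWeight hw]
      have := tupleWeight_add_unitTuple w (γ - unitTuple i j) i j
      rw [sub_unitTuple_add hγ.2] at this
      omega
    · intro γ hγ
      rw [mem_tuplesOfWeight hw] at hγ
      rw [Finset.mem_filter, mem_tuplesOfWeight hw, tupleWeight_add_unitTuple]
      refine ⟨by omega, by simp [unitTuple_apply]⟩
    · intro γ hγ
      exact sub_unitTuple_add (Finset.mem_filter.1 hγ).2
    · intro γ _
      exact add_tsub_cancel_right _ _
    · intro γ hγ
      exact if_neg (Finset.mem_filter.1 hγ).2
  · refine Finset.sum_eq_zero fun γ hγ => if_pos ?_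
    by_contra h0
    rw [mem_tuplesOfWeight hw] at hγ
    have := tupleWeight_add_unitTuple w (γ - unitTuple i j) i j
    rw [sub_unitTuple_add h0] at this
    omega

lemma qpoly_eq_sum_qterm {𝕜 : Type*} [RCLike 𝕜] (d n : ℕ) (a : ℕ → ℕ) (c : Fin d → ℕ → 𝕜)
    (m : ℕ) :
    qpoly d n a c m = ∑ γ ∈ tuplesOfWeight (Fin d) (fun j : Fin (n + 1) => a j) m,
      qterm (fun i (j : Fin (n + 1)) => c i j) γ :=
  Finset.sum_congr rfl fun γ _ => smul_prod_eq_qterm (fun i (j : Fin (n + 1)) => c i j) γ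

lemma pderiv_qpoly {𝕜 : Type*} [RCLike 𝕜] (d n : ℕ) (a : ℕ → ℕ) (c : Fin d → ℕ → 𝕜)
    (ha : ∀ j ≤ n, 1 ≤ a j) (m : ℕ) (i : Fin d) :
    pderiv i (qpoly d n a c m)
      = ∑ j ∈ Finset.range (n + 1),
          if a j ≤ m then C (c i j) * qpoly d n a c (m - a j) else 0 := by
  have hw : ∀ j : Fin (n + 1), 1 ≤ a j := fun j => ha j (Nat.le_of_lt_succ j.2)
  simp only [qpoly_eq_sum_qterm, map_sum, pderiv_qterm]
  rw [Finset.sum_comm, Finset.sum_range]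
  refine Finset.sum_congr rfl fun j _ => ?_
  rw [sum_tuplesOfWeight_sub_unitTuple hw m i j
    (fun γ => C (c i j) * qterm (fun i (j : Fin (n + 1)) => c i j) γ), Finset.mul_sum]

/-- for `a_n ≤ m ≤ a_1` and every `i`,
`∂q_{n,m}/∂x_i = c_{i,0} q_{n,m-1} + ∑_{j=s}^{n} c_{i,j} q_{n,m-a_j}`, where `s` is the
minimal integer in `{1,…,n}` with `m - a_s ≥ 0` (i.e. `a_s ≤ m`, and `m < a_t` for all
`1 ≤ t < s`). -/
theorem pderiv_qpoly_of_ge {𝕜 : Type*} [RCLike 𝕜] (d n : ℕ)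
    (hd : 1 ≤ d) (hn : 1 ≤ n) (a : ℕ → ℕ) (c : Fin d → ℕ → 𝕜)
    (ha0 : a 0 = 1) (hadec : ∀ j, 1 ≤ j → j < n → a (j + 1) < a j) (han : 2 ≤ a n)
    (hc : ∃ i : Fin d, c i 0 ≠ 0)
    (m s : ℕ) (hm1 : a n ≤ m) (hm2 : m ≤ a 1)
    (hs1 : 1 ≤ s) (hs2 : s ≤ n) (hsle : a s ≤ m)
    (hsmin : ∀ t, 1 ≤ t → t < s → m < a t) (i : Fin d) :
    pderiv i (qpoly d n a c m)
      = C (c i 0) * qpoly d n a c (m - 1)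
        + ∑ j ∈ Finset.Icc s n, C (c i j) * qpoly d n a c (m - a j) := by
  have hanti : ∀ j k, 1 ≤ j → j ≤ k → k ≤ n → a k ≤ a j := by
    intro j k hj hjk
    induction k, hjk using Nat.le_induction with
    | base => exact fun _ => le_rfl
    | succ k hjk ih =>
      exact fun hk => (hadec k (hj.trans hjk) hk).le.trans (ih (Nat.le_of_succ_le hk))
  have hpos : ∀ j ≤ n, 1 ≤ a j := by
    intro j hj
    rcases Nat.eq_zero_or_pos j with rfl | hj0
    · exact ha0.ge
    · have := hanti j n hj0 hj le_rfl
      omega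
  rw [pderiv_qpoly d n a c hpos, ← Finset.sum_filter]
  have hset : (Finset.range (n + 1)).filter (fun j => a j ≤ m) = insert 0 (Finset.Icc s n) := by
    ext j
    simp only [Finset.mem_filter, Finset.mem_range, Finset.mem_insert, Finset.mem_Icc]
    constructor
    · rintro ⟨hjn, hjm⟩
      by_contra! hj
      have hjs : j < s := by
        by_contra! hsj
        have := hj.2 hsj
        omega
      exact absurd hjm (hsmin j (Nat.pos_of_ne_zero hj.1) hjs).not_ge
    · rintro (rfl | ⟨hsj, hjn⟩)
      · omega
      · exact ⟨by omega, (hanti s j hs1 hsj hjn).trans hsle⟩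
  rw [hset, Finset.sum_insert (by simp; omega), ha0]
end

section
/- Suppose n ≥ 2, and let q_{n-1,r} (for 0 ≤ r ≤ a_1) denote the polynomials constructed from the truncated data a' = (a_0, a_1, ..., a_{n-1}) and c_i' = (c_{i,0}, ..., c_{i,n-1}), i = 1,...,d. Then for every 0 ≤ m ≤ a_1, q_{n,m} = Σ_{l=0}^{k} (1/l!) · (c_{1,n} x_1 + ⋯ + c_{d,n} x_d)^l · q_{n-1, m - l·a_n}, where k is the maximal nonnegative integer with k·a_n ≤ m. -/
open MvPolynomial

/-- The tuples `γ` with `τ(γ) = m`, the index set of the sum defining `qpoly d n a c m`. -/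
def qpolyIndex (d n : ℕ) (a : ℕ → ℕ) (m : ℕ) : Finset (Fin d → Fin (n + 1) → ℕ) :=
  (Fintype.piFinset fun _ : Fin d =>
      Fintype.piFinset fun _ : Fin (n + 1) => Finset.range (m + 1)).filter
    (fun γ => ∑ j : Fin (n + 1), a j.1 * ∑ i, γ i j = m)

theorem mem_qpolyIndex {d n : ℕ} {a : ℕ → ℕ} (ha : ∀ j ≤ n, 0 < a j) {m : ℕ}
    {γ : Fin d → Fin (n + 1) → ℕ} :
    γ ∈ qpolyIndex d n a m ↔ ∑ j : Fin (n + 1), a j.1 * ∑ i, γ i j = m := by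
  simp only [qpolyIndex, Finset.mem_filter, Fintype.mem_piFinset, Finset.mem_range,
    and_iff_right_iff_imp]
  intro h i j
  rw [Nat.lt_succ_iff, ← h]
  calc γ i j ≤ ∑ i, γ i j :=
        Finset.single_le_sum (f := fun i => γ i j) (fun _ _ => Nat.zero_le _) (Finset.mem_univ i)
    _ ≤ a j.1 * ∑ i, γ i j := Nat.le_mul_of_pos_left _ (ha _ (Nat.lt_succ_iff.mp j.2))
    _ ≤ _ := Finset.single_le_sum (f := fun j : Fin (n + 1) => a j.1 * ∑ i, γ i j)
        (fun _ _ => Nat.zero_le _) (Finset.mem_univ j)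

/-- The summands of `qpoly` factor over the entries of `γ`. -/
theorem qpoly_eq_sum_prod {𝕜 : Type*} [RCLike 𝕜] (d n : ℕ) (a : ℕ → ℕ) (c : Fin d → ℕ → 𝕜)
    (m : ℕ) :
    qpoly d n a c m = ∑ γ ∈ qpolyIndex d n a m,
      ∏ i, ∏ j, (C (c i j.1 ^ γ i j / ((γ i j).factorial : 𝕜)) * X i ^ γ i j) := by
  refine Finset.sum_congr rfl fun γ _ => ?_
  simp only [Finset.prod_mul_distrib, ← map_prod, Finset.prod_div_distrib,
    Finset.prod_pow_eq_pow_sum, smul_eq_C_mul, Nat.cast_prod]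

/-- The multinomial theorem in divided-power form. -/
theorem inv_factorial_smul_sum_pow {𝕜 : Type*} [Field 𝕜] [CharZero 𝕜] {ι : Type*} [Fintype ι]
    [DecidableEq ι] (b : ι → 𝕜) (l : ℕ) :
    ((l.factorial : 𝕜))⁻¹ • (∑ i, C (b i) * X i : MvPolynomial ι 𝕜) ^ l
      = ∑ β ∈ Finset.piAntidiag Finset.univ l,
          ∏ i, (C (b i ^ β i / ((β i).factorial : 𝕜)) * X i ^ β i) := by
  rw [Finset.sum_pow_eq_sum_piAntidiag, Finset.smul_sum]
  refine Finset.sum_congr rfl fun β hβ => ?_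
  obtain ⟨hβ, -⟩ := Finset.mem_piAntidiag.mp hβ
  have hspec := congrArg (Nat.cast (R := 𝕜)) (Nat.multinomial_spec Finset.univ β)
  rw [hβ, Nat.cast_mul, Nat.cast_prod] at hspec
  have hne : (∏ i, ((β i).factorial : 𝕜)) ≠ 0 :=
    Finset.prod_ne_zero_iff.mpr fun i _ => Nat.cast_ne_zero.mpr (Nat.factorial_ne_zero _)
  have hl : (l.factorial : 𝕜) ≠ 0 := Nat.cast_ne_zero.mpr (Nat.factorial_ne_zero _)
  simp only [mul_pow, Finset.prod_mul_distrib, ← map_pow, ← map_prod, Finset.prod_div_distrib,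
    smul_eq_C_mul]
  rw [← map_natCast (C : 𝕜 →+* MvPolynomial ι 𝕜), ← mul_assoc, ← mul_assoc, ← map_mul, ← map_mul]
  congr 2
  field_simp
  rw [← hspec]
  ring

/-- Splitting off the last column of exponents, for arbitrary positive weights. -/
theorem qpoly_succ {𝕜 : Type*} [RCLike 𝕜] (d n : ℕ) (a : ℕ → ℕ) (c : Fin d → ℕ → 𝕜)
    (ha : ∀ j ≤ n + 1, 0 < a j) (m k : ℕ) (hk1 : k * a (n + 1) ≤ m)
    (hk2 : m < (k + 1) * a (n + 1)) :
    qpoly d (n + 1) a c m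
      = ∑ l ∈ Finset.range (k + 1),
          ((l.factorial : 𝕜))⁻¹ •
            ((∑ i, C (c i (n + 1)) * X i) ^ l * qpoly d n a c (m - l * a (n + 1))) := by
  have ha' : ∀ j ≤ n, 0 < a j := fun j hj => ha j (hj.trans n.le_succ)
  simp only [← smul_mul_assoc, inv_factorial_smul_sum_pow, qpoly_eq_sum_prod,
    Finset.sum_mul_sum, ← Finset.sum_product']
  rw [Finset.sum_sigma']
  refine Finset.sum_bij'
    (fun γ _ => ⟨∑ i, γ i (Fin.last _), fun i => γ i (Fin.last _), fun i j => γ i j.castSucc⟩)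
    (fun p _ i => Fin.snoc (p.2.2 i) (p.2.1 i)) ?_ ?_ ?_ ?_ ?_
  · intro γ hγ
    rw [mem_qpolyIndex ha, Fin.sum_univ_castSucc] at hγ
    simp only [Fin.val_castSucc, Fin.val_last] at hγ
    have hlt : ∑ i, γ i (Fin.last _) < k + 1 := by
      refine Nat.lt_of_mul_lt_mul_right (a := a (n + 1)) (lt_of_le_of_lt ?_ hk2)
      rw [mul_comm]
      omega
    simp only [Finset.mem_sigma, Finset.mem_range, Finset.mem_product, Finset.mem_piAntidiag,
      mem_qpolyIndex ha']
    refine ⟨hlt, ⟨trivial, fun i _ => Finset.mem_univ i⟩, ?_⟩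
    rw [mul_comm _ (a (n + 1))]
    omega
  · rintro ⟨l, β, γ⟩ hp
    simp only [Finset.mem_sigma, Finset.mem_range, Finset.mem_product, Finset.mem_piAntidiag,
      mem_qpolyIndex ha'] at hp
    obtain ⟨hl, ⟨hβ, -⟩, hγ⟩ := hp
    have hle : l * a (n + 1) ≤ m :=
      (Nat.mul_le_mul_right _ (Nat.lt_succ_iff.mp hl)).trans hk1
    rw [mem_qpolyIndex ha, Fin.sum_univ_castSucc]
    simp only [Fin.val_castSucc, Fin.val_last, Fin.snoc_castSucc, Fin.snoc_last]
    rw [hγ, hβ, mul_comm (a (n + 1))]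
    omega
  · intro γ _
    funext i
    exact Fin.snoc_init_self (γ i)
  · rintro ⟨l, β, γ⟩ hp
    simp only [Finset.mem_sigma, Finset.mem_product, Finset.mem_piAntidiag] at hp
    obtain ⟨-, ⟨rfl, -⟩, -⟩ := hp
    simp only [Fin.snoc_castSucc, Fin.snoc_last]
  · intro γ _
    simp only [Fin.prod_univ_castSucc, Finset.prod_mul_distrib, Fin.val_castSucc, Fin.val_last]
    ring

/-- for `n ≥ 2` and `0 ≤ m ≤ a_1`,
`q_{n,m} = ∑_{l=0}^{k} (1/l!) (c_{1,n} x_1 + ⋯ + c_{d,n} x_d)^l q_{n-1, m - l a_n}`,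
where `k` is the maximal nonnegative integer with `k a_n ≤ m` and the `q_{n-1,r}` are
built from the truncated data `(a_0,…,a_{n-1})`, `(c_{i,0},…,c_{i,n-1})`. -/
theorem qpoly_eq_sum_qpoly_pred {𝕜 : Type*} [RCLike 𝕜] (d n : ℕ)
    (hd : 1 ≤ d) (hn : 2 ≤ n) (a : ℕ → ℕ) (c : Fin d → ℕ → 𝕜)
    (ha0 : a 0 = 1) (hadec : ∀ j, 1 ≤ j → j < n → a (j + 1) < a j) (han : 2 ≤ a n)
    (hc : ∃ i : Fin d, c i 0 ≠ 0)
    (m k : ℕ) (hm : m ≤ a 1) (hk1 : k * a n ≤ m) (hk2 : m < (k + 1) * a n) :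
    qpoly d n a c m
      = ∑ l ∈ Finset.range (k + 1),
          ((l.factorial : 𝕜))⁻¹ •
            ((∑ i, C (c i n) * X i) ^ l * qpoly d (n - 1) a c (m - l * a n)) := by
  obtain ⟨n, rfl⟩ := Nat.exists_eq_add_of_le' (one_le_two.trans hn)
  refine qpoly_succ d n a c (fun j hj => ?_) m k hk1 hk2
  rcases Nat.eq_zero_or_pos j with rfl | hj0
  · rw [ha0]
    exact one_pos
  · refine Nat.decreasingInduction (motive := fun j _ => 1 ≤ j → 0 < a j)
      (fun i hi ih hi1 => ?_) (fun _ => two_pos.trans_le han) hj hj0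
    exact (ih (by omega)).trans (hadec i hi1 hi)
end

section
/- Suppose n ≥ 2 and let m satisfy a_n ≤ m < a_{n-1}. Then q_{n,m} = Σ_{l=0}^{k} 1/(l! · (m - l·a_n)!) · (c_{1,n} x_1 + ⋯ + c_{d,n} x_d)^l · (c_{1,0} x_1 + ⋯ + c_{d,0} x_d)^{m - l·a_n}, where k is the maximal nonnegative integer with k·a_n ≤ m. -/
open MvPolynomial

/-- The multinomial theorem in divided-power form, for a power of a linear form. -/
lemma inv_factorial_smul_sum_C_mul_X_pow {𝕜 σ : Type*} [Field 𝕜] [CharZero 𝕜] [Fintype σ]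
    [DecidableEq σ] (b : σ → 𝕜) (l : ℕ) :
    ((l.factorial : ℕ) : 𝕜)⁻¹ • (∑ i, C (b i) * X i : MvPolynomial σ 𝕜) ^ l
      = ∑ p ∈ Finset.univ.piAntidiag l,
          ((∏ i, b i ^ p i) / ((∏ i, (p i).factorial : ℕ) : 𝕜)) • ∏ i, X i ^ p i := by
  rw [Finset.sum_pow_eq_sum_piAntidiag, Finset.smul_sum]
  refine Finset.sum_congr rfl fun p hp => ?_
  have hpl : ∑ i, p i = l := (Finset.mem_piAntidiag.1 hp).1
  have hspec := Nat.multinomial_spec Finset.univ p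
  rw [hpl] at hspec
  have hl : ((l.factorial : ℕ) : 𝕜) ≠ 0 := Nat.cast_ne_zero.2 l.factorial_ne_zero
  have hp0 : ((∏ i, (p i).factorial : ℕ) : 𝕜) ≠ 0 :=
    Nat.cast_ne_zero.2 (Finset.prod_ne_zero_iff.2 fun i _ => (p i).factorial_ne_zero)
  have hcoef : ((l.factorial : ℕ) : 𝕜)⁻¹ * (Nat.multinomial Finset.univ p : 𝕜)
      = (((∏ i, (p i).factorial : ℕ) : 𝕜))⁻¹ := by
    rw [inv_mul_eq_iff_eq_mul₀ hl, eq_mul_inv_iff_mul_eq₀ hp0, ← hspec]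
    push_cast
    ring
  simp only [mul_pow, Finset.prod_mul_distrib, ← map_pow, ← map_prod, smul_eq_C_mul,
    ← C_eq_coe_nat]
  rw [div_eq_mul_inv, ← hcoef]
  simp only [map_mul]
  ring

/-- Exponents of weighted degree less than `a (n - 1)` involve only the weights
`a 0` and `a n`. -/
lemma eq_zero_of_weight_lt {d n : ℕ} {a : ℕ → ℕ} {m : ℕ}
    (hadec : ∀ j, 1 ≤ j → j < n → a (j + 1) < a j) (hm : m < a (n - 1))
    {γ : Fin d → Fin (n + 1) → ℕ} (hγ : ∑ j : Fin (n + 1), a j.1 * ∑ i, γ i j = m)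
    (i : Fin d) {j : Fin (n + 1)} (hj0 : j ≠ 0) (hjn : j ≠ Fin.last n) : γ i j = 0 := by
  have h1 : 1 ≤ j.1 := Nat.one_le_iff_ne_zero.2 fun h => hj0 (Fin.ext h)
  have h2 : j.1 < n := Fin.val_lt_last hjn
  have hanti : ∀ s, j.1 ≤ s → s < n → a s ≤ a j.1 := by
    intro s hs
    induction s, hs using Nat.le_induction with
    | base => exact fun _ => le_rfl
    | succ s hs ih =>
      exact fun h => (hadec s (h1.trans hs) (by omega)).le.trans (ih (by omega))
  have ha : a (n - 1) ≤ a j.1 := hanti _ (by omega) (by omega)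
  by_contra hne
  have h3 : 1 ≤ ∑ i, γ i j := (Nat.one_le_iff_ne_zero.2 hne).trans
    (Finset.single_le_sum (f := fun i => γ i j) (fun _ _ => Nat.zero_le _) (Finset.mem_univ i))
  have h4 : a j.1 * ∑ i, γ i j ≤ m := hγ ▸ Finset.single_le_sum
    (f := fun j : Fin (n + 1) => a j.1 * ∑ i, γ i j) (fun _ _ => Nat.zero_le _)
    (Finset.mem_univ j)
  nlinarith

/-- The exponent array with columns `q` at `0` and `p` at `n`, and zero elsewhere. -/
def exponentOfEnds {d : ℕ} (n : ℕ) (p q : Fin d → ℕ) (i : Fin d) (j : Fin (n + 1)) : ℕ :=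
  if j = 0 then q i else if j = Fin.last n then p i else 0

/-- for `n ≥ 2` and `a_n ≤ m < a_{n-1}`,
`q_{n,m} = ∑_{l=0}^{k} 1/(l!(m-l a_n)!) (c_{1,n} x_1+⋯+c_{d,n} x_d)^l
(c_{1,0} x_1+⋯+c_{d,0} x_d)^{m-l a_n}`, where `k` is the maximal nonnegative integer
with `k a_n ≤ m`. -/
theorem qpoly_eq_sum_linear_pows {𝕜 : Type*} [RCLike 𝕜] (d n : ℕ)
    (hd : 1 ≤ d) (hn : 2 ≤ n) (a : ℕ → ℕ) (c : Fin d → ℕ → 𝕜)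
    (ha0 : a 0 = 1) (hadec : ∀ j, 1 ≤ j → j < n → a (j + 1) < a j) (han : 2 ≤ a n)
    (hc : ∃ i : Fin d, c i 0 ≠ 0)
    (m k : ℕ) (hm1 : a n ≤ m) (hm2 : m < a (n - 1))
    (hk1 : k * a n ≤ m) (hk2 : m < (k + 1) * a n) :
    qpoly d n a c m
      = ∑ l ∈ Finset.range (k + 1),
          (((l.factorial * (m - l * a n).factorial : ℕ) : 𝕜))⁻¹ •
            ((∑ i, C (c i n) * X i) ^ l *
              (∑ i, C (c i 0) * X i) ^ (m - l * a n)) := by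
  have h0n : (0 : Fin (n + 1)) ≠ Fin.last n := fun h => by
    have := congrArg Fin.val h
    simp only [Fin.val_zero, Fin.val_last] at this
    omega
  have hweight : ∀ γ : Fin d → Fin (n + 1) → ℕ,
      (∀ i j, j ≠ 0 → j ≠ Fin.last n → γ i j = 0) →
      ∑ j : Fin (n + 1), a j.1 * ∑ i, γ i j = ∑ i, γ i 0 + a n * ∑ i, γ i (Fin.last n) := by
    intro γ h
    rw [Fintype.sum_eq_add 0 (Fin.last n) h0n fun j hj => by simp [h _ j hj.1 hj.2]]
    simp [ha0]
  have hterm : ∀ l ∈ Finset.range (k + 1),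
      (((l.factorial * (m - l * a n).factorial : ℕ) : 𝕜))⁻¹ •
            ((∑ i, C (c i n) * X i) ^ l *
              (∑ i, C (c i 0) * X i) ^ (m - l * a n) : MvPolynomial (Fin d) 𝕜)
      = ∑ x ∈ Finset.univ.piAntidiag l ×ˢ Finset.univ.piAntidiag (m - l * a n),
        (((∏ i, c i n ^ x.1 i) / ((∏ i, (x.1 i).factorial : ℕ) : 𝕜)) • ∏ i, X i ^ x.1 i) *
        (((∏ i, c i 0 ^ x.2 i) / ((∏ i, (x.2 i).factorial : ℕ) : 𝕜)) • ∏ i, X i ^ x.2 i) := by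
    intro l _
    rw [Nat.cast_mul, mul_inv, ← smul_mul_smul_comm, inv_factorial_smul_sum_C_mul_X_pow,
      inv_factorial_smul_sum_C_mul_X_pow, Finset.sum_mul_sum, Finset.sum_product]
  rw [Finset.sum_congr rfl hterm, Finset.sum_sigma', qpoly]
  refine Finset.sum_bij'
    (fun γ _ => ⟨∑ i, γ i (Fin.last n), fun i => γ i (Fin.last n), fun i => γ i 0⟩)
    (fun x _ => exponentOfEnds n x.2.1 x.2.2) ?_ ?_ ?_ ?_ ?_
  · intro γ hγ
    have hγ := (Finset.mem_filter.1 hγ).2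
    have hw := hweight γ fun i j => eq_zero_of_weight_lt hadec hm2 hγ i
    rw [hγ] at hw
    simp only [Finset.mem_sigma, Finset.mem_range, Finset.mem_product, Finset.mem_piAntidiag,
      Finset.mem_univ, implies_true, and_true, true_and]
    constructor
    · by_contra hlt
      have : (k + 1) * a n ≤ (∑ i, γ i (Fin.last n)) * a n :=
        Nat.mul_le_mul_right _ (not_lt.1 hlt)
      rw [mul_comm (a n)] at hw
      omega
    · rw [mul_comm, hw, Nat.add_sub_cancel]
  · rintro ⟨l, p, q⟩ hx
    simp only [Finset.mem_sigma, Finset.mem_range, Finset.mem_product, Finset.mem_piAntidiag,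
      Finset.mem_univ, implies_true, and_true] at hx
    obtain ⟨hl, hp, hq⟩ := hx
    have hla : l * a n ≤ m := (Nat.mul_le_mul_right _ (Nat.lt_succ_iff.1 hl)).trans hk1
    have hlm : l ≤ m := (Nat.le_mul_of_pos_right l (by omega)).trans hla
    simp only [Finset.mem_filter, Fintype.mem_piFinset, Finset.mem_range]
    constructor
    · intro i j
      have hpi : p i ≤ l :=
        hp ▸ Finset.single_le_sum (f := p) (fun _ _ => Nat.zero_le _) (Finset.mem_univ i)
      have hqi : q i ≤ m - l * a n :=
        hq ▸ Finset.single_le_sum (f := q) (fun _ _ => Nat.zero_le _) (Finset.mem_univ i)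
      unfold exponentOfEnds
      split_ifs <;> omega
    · rw [hweight _ fun i j h0 hn => by simp [exponentOfEnds, h0, hn]]
      simp only [exponentOfEnds, if_true, if_neg h0n.symm]
      rw [hp, hq, mul_comm (a n)]
      omega
  · intro γ hγ
    have hγ := (Finset.mem_filter.1 hγ).2
    funext i j
    unfold exponentOfEnds
    split_ifs with h0 hn
    · rw [h0]
    · rw [hn]
    · exact (eq_zero_of_weight_lt hadec hm2 hγ i h0 hn).symm
  · rintro ⟨l, p, q⟩ hx
    simp only [Finset.mem_sigma, Finset.mem_product, Finset.mem_piAntidiag] at hx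
    simp [exponentOfEnds, h0n.symm, hx.2.1.1]
  · intro γ hγ
    have hγ := (Finset.mem_filter.1 hγ).2
    have hz : ∀ i j, j ≠ 0 ∧ j ≠ Fin.last n → γ i j = 0 :=
      fun i j hj => eq_zero_of_weight_lt hadec hm2 hγ i hj.1 hj.2
    have hc' : ∀ i, ∏ j : Fin (n + 1), c i j.1 ^ γ i j
        = c i 0 ^ γ i 0 * c i n ^ γ i (Fin.last n) := fun i =>
      Fintype.prod_eq_mul 0 (Fin.last n) h0n fun j hj => by rw [hz i j hj, pow_zero]
    have hf : ∀ i, ∏ j, (γ i j).factorial = (γ i 0).factorial * (γ i (Fin.last n)).factorial :=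
      fun i => Fintype.prod_eq_mul 0 (Fin.last n) h0n fun j hj => by
        rw [hz i j hj, Nat.factorial_zero]
    have hs : ∀ i, ∑ j, γ i j = γ i 0 + γ i (Fin.last n) :=
      fun i => Fintype.sum_eq_add 0 (Fin.last n) h0n fun j hj => hz i j hj
    simp only [hc', hf, hs, pow_add, Finset.prod_mul_distrib, Nat.cast_mul]
    rw [smul_mul_smul_comm, div_mul_div_comm]
    congr 1
    · congr 1 <;> exact mul_comm _ _
    · exact mul_comm _ _
end

section
/- Let 0 ≤ m ≤ a_1, ξ ∈ 𝔽^d, and p ∈ 𝔽[x_1,...,x_d]. Then there exists a univariate polynomial g ∈ 𝔽[h] such that for every h ∈ 𝔽: Σ_{r=0}^{m} (-1)^{m-r} · C(m,r) · p(ξ + (Σ_{j=0}^n c_{1,j}(rh)^{a_j}, Σ_{j=0}^n c_{2,j}(rh)^{a_j}, ..., Σ_{j=0}^n c_{d,j}(rh)^{a_j})) = m! · h^m · (q_{n,m}(D) p)(ξ) + h^{m+1} g(h). (In particular, dividing by m! h^m for h ≠ 0, the divided difference equals (q_{n,m}(D)p)(ξ) + O(h).) -/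
open MvPolynomial

/-- The differential operator `∂^{‖β‖₁}/∂x_1^{β_1}⋯∂x_d^{β_d}`. -/
noncomputable def DMulti {𝕜 : Type*} [RCLike 𝕜] {d : ℕ} (β : Fin d → ℕ) :
    Module.End 𝕜 (MvPolynomial (Fin d) 𝕜) :=
  (List.ofFn fun i =>
    ((pderiv i).toLinearMap : Module.End 𝕜 (MvPolynomial (Fin d) 𝕜)) ^ β i).prod

/-- For a polynomial `q = ∑_β q̂(β) x^β`, the associated differential operator
`q(D) : f ↦ ∑_β q̂(β) ∂^{‖β‖₁} f / ∂x^β`. -/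
noncomputable def polyD {𝕜 : Type*} [RCLike 𝕜] {d : ℕ} (q : MvPolynomial (Fin d) 𝕜) :
    Module.End 𝕜 (MvPolynomial (Fin d) 𝕜) :=
  ∑ β ∈ q.support, q.coeff β • DMulti (fun i => β i)

theorem polyD_eq_sum_of_support_subset {𝕜 : Type*} [RCLike 𝕜] {d : ℕ}
    {q : MvPolynomial (Fin d) 𝕜} {s : Finset (Fin d →₀ ℕ)} (h : q.support ⊆ s) :
    polyD q = ∑ β ∈ s, q.coeff β • DMulti (fun i => β i) := by
  refine Finset.sum_subset h fun β _ hβ => ?_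
  rw [notMem_support_iff.mp hβ, zero_smul]

theorem polyD_add {𝕜 : Type*} [RCLike 𝕜] {d : ℕ} (q r : MvPolynomial (Fin d) 𝕜) :
    polyD (q + r) = polyD q + polyD r := by
  classical
  rw [polyD_eq_sum_of_support_subset (support_add (p := q) (q := r)),
    polyD_eq_sum_of_support_subset (q := q) Finset.subset_union_left,
    polyD_eq_sum_of_support_subset (q := r) Finset.subset_union_right,
    ← Finset.sum_add_distrib]
  simp [add_smul]

theorem polyD_sum {𝕜 : Type*} [RCLike 𝕜] {d : ℕ} {ι : Type*} (s : Finset ι)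
    (f : ι → MvPolynomial (Fin d) 𝕜) :
    polyD (∑ k ∈ s, f k) = ∑ k ∈ s, polyD (f k) :=
  map_sum (AddMonoidHom.mk' polyD polyD_add) f s

theorem polyD_smul_prod_X_pow {𝕜 : Type*} [RCLike 𝕜] {d : ℕ} (r : 𝕜) (β : Fin d → ℕ) :
    polyD (r • ∏ i, (X i : MvPolynomial (Fin d) 𝕜) ^ β i) = r • DMulti β := by
  have h : r • ∏ i, (X i : MvPolynomial (Fin d) 𝕜) ^ β i
      = monomial (Finsupp.equivFunOnFinite.symm β) r := by
    rw [monomial_eq, smul_eq_C_mul, Finsupp.prod_fintype _ _ (by simp)]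
    simp
  rw [h, polyD_eq_sum_of_support_subset support_monomial_subset]
  simp

theorem pderiv_pow_monomial {R σ : Type*} [CommSemiring R] (i : σ) (k : ℕ) (s : σ →₀ ℕ) (r : R) :
    (((pderiv i).toLinearMap : Module.End R (MvPolynomial σ R)) ^ k) (monomial s r)
      = monomial (s - Finsupp.single i k) (r * ((s i).descFactorial k : R)) := by
  induction k with
  | zero => simp
  | succ k ih =>
    rw [pow_succ', Module.End.mul_apply, ih]
    change pderiv i _ = _
    rw [pderiv_monomial]
    congr 1
    · rw [tsub_tsub, ← Finsupp.single_add]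
    · simp [Nat.descFactorial_succ]
      ring

theorem prod_map_pderiv_pow_monomial {R σ : Type*} [CommSemiring R] (β : σ → ℕ) (l : List σ)
    (hl : l.Nodup) (s : σ →₀ ℕ) (r : R) :
    (l.map fun i => ((pderiv i).toLinearMap : Module.End R (MvPolynomial σ R)) ^ β i).prod
        (monomial s r)
      = monomial (s - (l.map fun i => Finsupp.single i (β i)).sum)
          (r * (l.map fun i => ((s i).descFactorial (β i) : R)).prod) := by
  classical
  induction l with
  | nil => simp
  | cons i l ih =>
    obtain ⟨hi, hl'⟩ := List.nodup_cons.mp hl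
    have h0 : ((l.map fun i => Finsupp.single i (β i)).sum : σ →₀ ℕ) i = 0 := by
      clear ih hl hl'
      induction l with
      | nil => simp
      | cons j l ih =>
        simp only [List.mem_cons, not_or] at hi
        simp [ih hi.2, Ne.symm hi.1]
    rw [List.map_cons, List.prod_cons, Module.End.mul_apply, ih hl', pderiv_pow_monomial]
    congr 1
    · rw [tsub_tsub, List.map_cons, List.sum_cons, add_comm]
    · simp [h0]
      ring

theorem eval_DMulti_monomial {𝕜 : Type*} [RCLike 𝕜] {d : ℕ} (β : Fin d → ℕ) (s : Fin d →₀ ℕ)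
    (r : 𝕜) (ξ : Fin d → 𝕜) :
    eval ξ (DMulti β (monomial s r))
      = r * ∏ i, ((s i).descFactorial (β i) * ξ i ^ (s i - β i) : 𝕜) := by
  rw [DMulti, List.ofFn_eq_map, prod_map_pderiv_pow_monomial β _ (List.nodup_finRange d),
    eval_monomial, Finsupp.prod_fintype _ _ (by simp), Finset.prod_mul_distrib, mul_assoc,
    ← List.ofFn_eq_map, ← List.ofFn_eq_map, List.prod_ofFn, List.sum_ofFn]
  simp [Finsupp.single_apply]

/-- Multinomial expansion over a box of exponents containing all those that contribute. -/
theorem C_add_sum_pow_eq_sum {K : Type*} [Field K] [CharZero K] {ι : Type*} [Fintype ι]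
    [DecidableEq ι] (x : K) (c : ι → K) (a : ι → ℕ) {b N : ℕ} (hN : b < N) :
    (Polynomial.C x + ∑ j, Polynomial.C (c j) * Polynomial.X ^ a j) ^ b
      = ∑ γ ∈ Fintype.piFinset fun _ : ι => Finset.range N,
          Polynomial.C ((b.descFactorial (∑ j, γ j) * x ^ (b - ∑ j, γ j)) *
            ((∏ j, c j ^ γ j) / ((∏ j, (γ j).factorial : ℕ) : K)))
          * Polynomial.X ^ (∑ j, a j * γ j) := by
  rw [add_comm, add_pow]
  rw [← Finset.sum_filter_of_ne (p := fun γ : ι → ℕ => ∑ j, γ j ∈ Finset.range (b + 1))]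
  swap
  · intro γ _ hγ
    contrapose! hγ
    rw [Nat.descFactorial_eq_zero_iff_lt.mpr (by simpa using hγ)]
    simp
  rw [← Finset.sum_fiberwise_of_maps_to (t := Finset.range (b + 1)) (g := fun γ : ι → ℕ => ∑ j, γ j)
    (fun γ hγ => (Finset.mem_filter.mp hγ).2)]
  refine Finset.sum_congr rfl fun k hk => ?_
  have hk' : k < b + 1 := Finset.mem_range.mp hk
  have hs : ({γ ∈ {γ ∈ Fintype.piFinset fun _ : ι => Finset.range N |
      ∑ j, γ j ∈ Finset.range (b + 1)} | ∑ j, γ j = k} : Finset (ι → ℕ))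
      = Finset.piAntidiag Finset.univ k := by
    ext γ
    simp only [Finset.mem_filter, Fintype.mem_piFinset, Finset.mem_range, Finset.mem_piAntidiag,
      Finset.mem_univ, implies_true, and_true]
    refine ⟨fun h => h.2, fun (h : ∑ j, γ j = k) => ⟨⟨fun j => ?_, by omega⟩, h⟩⟩
    have : γ j ≤ ∑ j, γ j := Finset.single_le_sum (f := γ) (fun _ _ => Nat.zero_le _) (Finset.mem_univ j)
    omega
  rw [hs, Finset.sum_pow_eq_sum_piAntidiag, Finset.sum_mul, Finset.sum_mul]
  refine Finset.sum_congr rfl fun γ hγ => ?_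
  have hγk : ∑ j, γ j = k := (Finset.mem_piAntidiag.mp hγ).1
  have hmul : ((b.descFactorial k : ℕ) : K)
      = b.choose k * Nat.multinomial Finset.univ γ * (∏ j, (γ j).factorial : ℕ) := by
    rw [Nat.descFactorial_eq_factorial_mul_choose, ← hγk, ← Nat.multinomial_spec]
    push_cast
    ring
  have hne : ((∏ j, (γ j).factorial : ℕ) : K) ≠ 0 :=
    Nat.cast_ne_zero.mpr (Finset.prod_ne_zero_iff.mpr fun j _ => Nat.factorial_ne_zero _)
  have hc : (b.descFactorial k * x ^ (b - k)) *
      ((∏ j, c j ^ γ j) / ((∏ j, (γ j).factorial : ℕ) : K))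
      = Nat.multinomial Finset.univ γ * (∏ j, c j ^ γ j) * x ^ (b - k) * b.choose k := by
    rw [hmul]
    field_simp
  rw [hγk, hc]
  simp only [mul_pow, Finset.prod_mul_distrib, ← pow_mul, Finset.prod_pow_eq_pow_sum, map_mul,
    map_pow, map_prod, map_natCast]
  ring

theorem coeff_aeval_curve_eq_eval_polyD_qpoly {𝕜 : Type*} [RCLike 𝕜] (d n : ℕ) (a : ℕ → ℕ)
    (c : Fin d → ℕ → 𝕜) (ha : ∀ j ≤ n, 0 < a j) (m : ℕ) (ξ : Fin d → 𝕜)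
    (p : MvPolynomial (Fin d) 𝕜) :
    (aeval (fun i => Polynomial.C (ξ i) +
        ∑ j : Fin (n + 1), Polynomial.C (c i j) * Polynomial.X ^ a j) p).coeff m
      = eval ξ (polyD (qpoly d n a c m) p) := by
  induction p using MvPolynomial.induction_on' with
  | add p q hp hq => simp only [map_add, Polynomial.coeff_add, hp, hq]
  | monomial s r =>
    have hN (i : Fin d) : s i < max m (∑ i, s i) + 1 := by
      have := Finset.single_le_sum (f := s) (fun _ _ => Nat.zero_le _) (Finset.mem_univ i)
      omega
    rw [qpoly, polyD_sum, LinearMap.sum_apply, map_sum, aeval_monomial,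
      Finsupp.prod_fintype _ _ (by simp)]
    simp only [polyD_smul_prod_X_pow, LinearMap.smul_apply, smul_eval, eval_DMulti_monomial,
      C_add_sum_pow_eq_sum (K := 𝕜) _ _ _ (hN _), Finset.prod_univ_sum,
      Finset.prod_mul_distrib, ← map_prod, Finset.prod_pow_eq_pow_sum,
      Polynomial.algebraMap_eq, Polynomial.coeff_C_mul, Polynomial.finsetSum_coeff,
      Polynomial.coeff_X_pow, mul_ite, mul_one, mul_zero, ← Finset.sum_filter, Finset.mul_sum]
    symm
    refine Finset.sum_congr ?_ fun γ _ => ?_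
    · ext γ
      simp only [Finset.mem_filter, Fintype.mem_piFinset, Finset.mem_range]
      rw [Finset.sum_comm, eq_comm (a := m)]
      refine and_congr_left fun h => iff_of_true ?_ ?_
      all_goals
        intro i j
        have h1 := Finset.single_le_sum (f := fun i => ∑ j : Fin (n + 1), a j * γ i j)
          (fun _ _ => Nat.zero_le _) (Finset.mem_univ i)
        have h2 := Finset.single_le_sum (f := fun j : Fin (n + 1) => a j * γ i j)
          (fun _ _ => Nat.zero_le _) (Finset.mem_univ j)
        have h3 := Nat.le_mul_of_pos_left (γ i j) (ha j (Nat.lt_succ_iff.mp j.2))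
        omega
    · simp only [Nat.cast_prod, Finset.prod_div_distrib]
      ring

theorem sum_neg_one_pow_mul_choose_mul_pow_of_lt {R : Type*} [CommRing R] {k m : ℕ} (h : k < m) :
    ∑ r ∈ Finset.range (m + 1), (-1 : R) ^ (m - r) * (m.choose r : R) * (r : R) ^ k = 0 := by
  have := congrFun (fwdDiff_iter_pow_eq_zero_of_lt (R := R) h) 0
  rw [fwdDiff_iter_eq_sum_shift] at this
  simpa using this

theorem sum_neg_one_pow_mul_choose_mul_pow_self {R : Type*} [CommRing R] (m : ℕ) :
    ∑ r ∈ Finset.range (m + 1), (-1 : R) ^ (m - r) * (m.choose r : R) * (r : R) ^ m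
      = (m.factorial : R) := by
  have := congrFun (fwdDiff_iter_eq_factorial (R := R) (n := m)) 0
  rw [fwdDiff_iter_eq_sum_shift] at this
  simpa using this

theorem exists_sum_neg_one_pow_mul_choose_mul_eval_eq {R : Type*} [CommRing R]
    (P : Polynomial R) (m : ℕ) :
    ∃ g : Polynomial R, ∀ h : R,
      ∑ r ∈ Finset.range (m + 1), (-1 : R) ^ (m - r) * (m.choose r : R) * P.eval ((r : R) * h)
        = (m.factorial : R) * h ^ m * P.coeff m + h ^ (m + 1) * g.eval h := by
  induction P using Polynomial.induction_on' with
  | add p q hp hq =>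
    obtain ⟨g, hg⟩ := hp
    obtain ⟨k, hk⟩ := hq
    refine ⟨g + k, fun h => ?_⟩
    simp only [Polynomial.eval_add, mul_add, Finset.sum_add_distrib, hg, hk, Polynomial.coeff_add]
    ring
  | monomial k u =>
    have key (h : R) : ∑ r ∈ Finset.range (m + 1), (-1 : R) ^ (m - r) * (m.choose r : R) *
        (Polynomial.monomial k u).eval ((r : R) * h)
        = (∑ r ∈ Finset.range (m + 1), (-1 : R) ^ (m - r) * (m.choose r : R) * (r : R) ^ k)
          * (u * h ^ k) := by
      rw [Finset.sum_mul]
      refine Finset.sum_congr rfl fun r _ => ?_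
      rw [Polynomial.eval_monomial, mul_pow]
      ring
    simp only [key]
    rcases lt_trichotomy k m with hkm | rfl | hkm
    · refine ⟨0, fun h => ?_⟩
      rw [sum_neg_one_pow_mul_choose_mul_pow_of_lt hkm, Polynomial.coeff_monomial_of_ne _ hkm.ne']
      simp
    · refine ⟨0, fun h => ?_⟩
      rw [sum_neg_one_pow_mul_choose_mul_pow_self, Polynomial.coeff_monomial_same]
      simp
      ring
    · refine ⟨Polynomial.monomial (k - (m + 1)) ((∑ r ∈ Finset.range (m + 1),
        (-1 : R) ^ (m - r) * (m.choose r : R) * (r : R) ^ k) * u), fun h => ?_⟩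
      rw [Polynomial.coeff_monomial_of_ne _ hkm.ne, Polynomial.eval_monomial]
      obtain ⟨e, rfl⟩ := Nat.exists_eq_add_of_lt hkm
      rw [show m + e + 1 - (m + 1) = e by omega]
      ring

/-- for `0 ≤ m ≤ a_1`, `ξ ∈ 𝔽^d` and `p ∈ 𝔽[x]`, there is a univariate
polynomial `g` such that for all `h`,
`∑_{r=0}^m (-1)^{m-r} C(m,r) p(ξ + (∑_j c_{1,j}(rh)^{a_j}, …, ∑_j c_{d,j}(rh)^{a_j}))
  = m! h^m (q_{n,m}(D)p)(ξ) + h^{m+1} g(h)`. -/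
theorem divided_difference_eq_qpolyD_add_O_h {𝕜 : Type*} [RCLike 𝕜] (d n : ℕ)
    (hd : 1 ≤ d) (hn : 1 ≤ n) (a : ℕ → ℕ) (c : Fin d → ℕ → 𝕜)
    (ha0 : a 0 = 1) (hadec : ∀ j, 1 ≤ j → j < n → a (j + 1) < a j) (han : 2 ≤ a n)
    (hc : ∃ i : Fin d, c i 0 ≠ 0)
    (m : ℕ) (hm : m ≤ a 1) (ξ : Fin d → 𝕜) (p : MvPolynomial (Fin d) 𝕜) :
    ∃ g : Polynomial 𝕜, ∀ h : 𝕜,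
      ∑ r ∈ Finset.range (m + 1),
        (-1 : 𝕜) ^ (m - r) * ((m.choose r : ℕ) : 𝕜) *
          eval (fun i => ξ i + ∑ j ∈ Finset.range (n + 1), c i j * ((r : 𝕜) * h) ^ a j) p
      = (m.factorial : 𝕜) * h ^ m * eval ξ (polyD (qpoly d n a c m) p)
          + h ^ (m + 1) * g.eval h := by
  have ha : ∀ j ≤ n, 0 < a j := by
    intro j hj
    rcases Nat.eq_zero_or_pos j with rfl | hj0
    · omega
    · rcases hj.lt_or_eq with h | rfl
      · exact Nat.zero_lt_of_lt (hadec j hj0 h)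
      · omega
  obtain ⟨g, hg⟩ := exists_sum_neg_one_pow_mul_choose_mul_eval_eq
    (aeval (fun i => Polynomial.C (ξ i) +
      ∑ j : Fin (n + 1), Polynomial.C (c i j) * Polynomial.X ^ a j) p) m
  refine ⟨g, fun h => ?_⟩
  rw [← coeff_aeval_curve_eq_eval_polyD_qpoly d n a c ha m ξ p, ← hg h]
  refine Finset.sum_congr rfl fun r _ => ?_
  congr 1
  rw [← Polynomial.coe_aeval_eq_eval, ← AlgHom.comp_apply, comp_aeval, ← aeval_eq_eval]
  simp [Finset.sum_range, Polynomial.eval_finsetSum]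
end

section
/- With the data below, let Λ be the finite family of linear functionals on 𝔽[x_1,...,x_d] consisting of f ↦ (D_{ρ^{(k)}}^{α} f)(ξ^{(k)}) for 1 ≤ k ≤ μ and α ∈ Δ^{(k)}, together with f ↦ (q^{(l)}_{n(l),m}(D) f)(ξ^{(μ+l)}) for 1 ≤ l ≤ ν and 0 ≤ m ≤ a_1^{(l)}. Suppose V ⊆ 𝔽[x_1,...,x_d] is a finite-dimensional subspace such that for every f ∈ 𝔽[x_1,...,x_d] there is a unique g ∈ V with λ(g) = λ(f) for all λ ∈ Λ. Then there exists η > 0 such that for every h ∈ 𝔽 with 0 < |h| < η, the following Lagrange interpolation problem is uniquely solvable from V: for every f ∈ 𝔽[x_1,...,x_d] there exists a unique g ∈ V satisfying g(ξ^{(k)} + h·Σ_{i=1}^d α_i ρ_i^{(k)}) = f(ξ^{(k)} + h·Σ_{i=1}^d α_i ρ_i^{(k)}) for all 1 ≤ k ≤ μ, α ∈ Δ^{(k)}, and g(ξ^{(μ+l)} + φ^{(l)}(mh)) = f(ξ^{(μ+l)} + φ^{(l)}(mh)) for all 1 ≤ l ≤ ν, 0 ≤ m ≤ a_1^{(l)}.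 -/
open MvPolynomial

/-- The directional derivative operator `D_ρ f = ∑ i ρ_i ∂f/∂x_i`. -/
noncomputable def dirDeriv {𝕜 : Type*} [RCLike 𝕜] {d : ℕ} (ρ : Fin d → 𝕜) :
    Module.End 𝕜 (MvPolynomial (Fin d) 𝕜) :=
  ∑ i, ρ i • (pderiv i).toLinearMap

/-- The composed directional derivative `D_ρ^α = D_{ρ_1}^{α_1} ∘ ⋯ ∘ D_{ρ_d}^{α_d}`. -/
noncomputable def dirDerivMulti {𝕜 : Type*} [RCLike 𝕜] {d : ℕ}
    (ρ : Fin d → (Fin d → 𝕜)) (α : Fin d → ℕ) :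
    Module.End 𝕜 (MvPolynomial (Fin d) 𝕜) :=
  (List.ofFn fun i => (dirDeriv (ρ i)) ^ α i).prod

/-- A unisolvent interpolation problem on `V` remains unisolvent when the functionals `T` are
replaced by functionals `S h` whose vanishing forces that of a continuous perturbation `P h`
of `T`. -/
theorem exists_unisolvent_of_continuous_perturbation {𝕜 E Λ : Type*} [RCLike 𝕜] [AddCommGroup E]
    [Module 𝕜 E] [Finite Λ] (V : Submodule 𝕜 E)
    (T : E →ₗ[𝕜] (Λ → 𝕜)) (hT : Function.Surjective T)
    (hV : ∀ f, ∃! g, g ∈ V ∧ T g = T f) (S P : 𝕜 → E →ₗ[𝕜] (Λ → 𝕜))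
    (hP : ∀ g, Continuous fun h => P h g) (hP0 : P 0 = T)
    (hSP : ∀ h, h ≠ 0 → ∀ g, S h g = 0 → P h g = 0) :
    ∃ η : ℝ, 0 < η ∧ ∀ h : 𝕜, 0 < ‖h‖ → ‖h‖ < η → ∀ f, ∃! g, g ∈ V ∧ S h g = S h f := by
  classical
  have := Fintype.ofFinite Λ
  have hbij : Function.Bijective (T.domRestrict V) := by
    constructor
    · intro x y hxy
      obtain ⟨g, -, hg⟩ := hV x
      have hx := hg x ⟨x.2, rfl⟩
      have hy := hg y ⟨y.2, hxy.symm⟩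
      exact Subtype.ext (hx.trans hy.symm)
    · intro y
      obtain ⟨f, rfl⟩ := hT y
      obtain ⟨g, ⟨hg, hgf⟩, -⟩ := hV f
      exact ⟨⟨g, hg⟩, hgf⟩
  let e := LinearEquiv.ofBijective (T.domRestrict V) hbij
  let r : (Λ → 𝕜) →ₗ[𝕜] E := V.subtype ∘ₗ e.symm.toLinearMap
  have hr0 : T ∘ₗ r = LinearMap.id := LinearMap.ext fun x => e.apply_symm_apply x
  have hcont : Continuous fun h => (LinearMap.toMatrix' (P h ∘ₗ r)).det := by
    refine Continuous.matrix_det ?_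
    refine continuous_matrix fun i j => ?_
    simp only [LinearMap.toMatrix'_apply]
    exact (continuous_apply i).comp (hP _)
  have h0 : (LinearMap.toMatrix' (P 0 ∘ₗ r)).det ≠ 0 := by
    simp [hP0, hr0]
  obtain ⟨η, hη, hball⟩ := Metric.eventually_nhds_iff.1 (hcont.continuousAt.eventually_ne h0)
  refine ⟨η, hη, fun h hpos hlt f => ?_⟩
  have hdet := hball (by simpa using hlt : dist h 0 < η)
  have hPinj : ∀ x, P h (r x) = 0 → x = 0 := fun x hx => by
    by_contra hne
    refine hdet (Matrix.exists_mulVec_eq_zero_iff.1 ⟨x, hne, ?_⟩)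
    rw [LinearMap.toMatrix'_mulVec]
    exact hx
  have hSinj : Function.Injective (S h ∘ₗ r) := by
    rw [injective_iff_map_eq_zero]
    exact fun x hx => hPinj x (hSP h (norm_pos_iff.1 hpos) _ hx)
  obtain ⟨x, hx⟩ := LinearMap.injective_iff_surjective.1 hSinj (S h f)
  refine ⟨r x, ⟨(e.symm x).2, hx⟩, fun g hg => ?_⟩
  have hrg : r (T g) = g := congrArg Subtype.val (e.symm_apply_apply ⟨g, hg.1⟩)
  rw [← hrg]
  exact congrArg r (hSinj (by
    change S h (r (T g)) = _
    rw [hrg, hg.2, hx]))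

/-- If every `p ∈ m_ξ` is mapped by `Ψ ξ` into the ideal of variables, then the jets at finitely
many distinct points can be prescribed independently. -/
theorem exists_coeff_eq_of_pairwise_ne {𝕜 K σ τ : Type*} [Field 𝕜] [Finite K]
    (ξ : K → τ → 𝕜) (hξ : Function.Injective ξ)
    (Ψ : K → MvPolynomial τ 𝕜 →ₐ[𝕜] MvPolynomial σ 𝕜)
    (hΨ : ∀ p i, constantCoeff (Ψ p (X i)) = ξ p i)
    (N : ℕ) (F : K → MvPolynomial τ 𝕜) :
    ∃ f, ∀ p, ∀ γ : σ →₀ ℕ, γ.degree < N → coeff γ (Ψ p f) = coeff γ (Ψ p (F p)) := by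
  have hmax : ∀ p, (RingHom.ker (eval (ξ p))).IsMaximal := fun p =>
    RingHom.ker_isMaximal_of_surjective _ fun c => ⟨C c, by simp⟩
  have hcop : Pairwise (Function.onFun IsCoprime fun p => RingHom.ker (eval (ξ p)) ^ N) := by
    intro p q hpq
    refine IsCoprime.pow (Ideal.isCoprime_of_isMaximal fun heq => hpq (hξ (funext fun i => ?_)))
    have hmem : (X i - C (ξ p i) : MvPolynomial τ 𝕜) ∈ RingHom.ker (eval (ξ p)) := by simp
    rw [heq, RingHom.mem_ker] at hmem
    simpa [sub_eq_zero, eq_comm] using hmem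
  obtain ⟨f, hf⟩ := Ideal.exists_forall_sub_mem_ideal hcop F
  refine ⟨f, fun p γ hγ => ?_⟩
  have hconst : ∀ g, constantCoeff (Ψ p g) = eval (ξ p) g := fun g => by
    have : (constantCoeff.comp (Ψ p).toRingHom) = eval (ξ p) :=
      MvPolynomial.ringHom_ext (fun c => by simp) fun i => by simpa using hΨ p i
    exact DFunLike.congr_fun this g
  have hle : Ideal.map (Ψ p).toRingHom (RingHom.ker (eval (ξ p))) ≤ idealOfVars σ 𝕜 := by
    rw [Ideal.map_le_iff_le_comap]
    intro g hg
    rw [Ideal.mem_comap, ← pow_one (idealOfVars σ 𝕜), mem_pow_idealOfVars_iff']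
    intro x hx
    have hx0 : x = 0 := by
      rw [← Finsupp.degree_eq_zero_iff]; omega
    subst hx0
    exact (hconst g).trans hg
  have hmem := Ideal.pow_right_mono hle N (Ideal.map_pow (Ψ p).toRingHom _ N ▸
    Ideal.mem_map_of_mem (Ψ p).toRingHom (hf p))
  have h0 := (mem_pow_idealOfVars_iff' N _).1 hmem γ hγ
  simpa [sub_eq_zero] using h0

/-- The `n`-th forward difference at `0` with unit step of `x ↦ x ^ m`. -/
def fwdDiffPow (R : Type*) [CommRing R] (n m : ℕ) : R :=
  ∑ k ∈ Finset.range (n + 1), ((-1) ^ (n - k) * n.choose k) * (k : R) ^ m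

theorem fwdDiffPow_eq (R : Type*) [CommRing R] (n m : ℕ) :
    fwdDiffPow R n m = (fwdDiff (1 : R))^[n] (fun r => r ^ m) 0 := by
  rw [fwdDiff_iter_eq_sum_shift]
  simp [fwdDiffPow]

theorem fwdDiffPow_of_lt (R : Type*) [CommRing R] {n m : ℕ} (h : m < n) :
    fwdDiffPow R n m = 0 := by
  rw [fwdDiffPow_eq, fwdDiff_iter_pow_eq_zero_of_lt h, Pi.zero_apply]

theorem fwdDiffPow_self (R : Type*) [CommRing R] (n : ℕ) :
    fwdDiffPow R n n = n.factorial := by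
  rw [fwdDiffPow_eq, fwdDiff_iter_eq_factorial]
  rfl

/-- The functional taking `F` to its multivariate forward difference of order `α` with step `h`
at the origin, divided by `α! h ^ |α|`; it extends continuously to `h = 0`. -/
noncomputable def dividedFwdDiff {𝕜 σ : Type*} [Field 𝕜] [Fintype σ] (α : σ → ℕ) (h : 𝕜) :
    MvPolynomial σ 𝕜 →ₗ[𝕜] 𝕜 :=
  (basisMonomials σ 𝕜).constr 𝕜 fun γ =>
    (∏ i, fwdDiffPow 𝕜 (α i) (γ i)) / (∏ i, ((α i).factorial : 𝕜)) * h ^ (∑ i, γ i - ∑ i, α i)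

theorem dividedFwdDiff_monomial {𝕜 σ : Type*} [Field 𝕜] [Fintype σ] (α : σ → ℕ) (h : 𝕜)
    (γ : σ →₀ ℕ) : dividedFwdDiff α h (monomial γ 1) =
      (∏ i, fwdDiffPow 𝕜 (α i) (γ i)) / (∏ i, ((α i).factorial : 𝕜)) *
        h ^ (∑ i, γ i - ∑ i, α i) := by
  exact (congrArg _ (congrFun (coe_basisMonomials σ 𝕜) γ).symm).trans
    (Module.Basis.constr_basis _ _ _ _)

theorem dividedFwdDiff_zero {𝕜 σ : Type*} [Field 𝕜] [CharZero 𝕜] [Fintype σ] (α : σ → ℕ) :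
    dividedFwdDiff α (0 : 𝕜) = lcoeff 𝕜 (Finsupp.equivFunOnFinite.symm α) := by
  classical
  refine (basisMonomials σ 𝕜).ext fun γ => ?_
  rw [coe_basisMonomials, dividedFwdDiff_monomial, lcoeff_apply, coeff_monomial]
  split_ifs with hγ
  · subst hγ
    have : (∏ i, ((α i).factorial : 𝕜)) ≠ 0 :=
      Finset.prod_ne_zero_iff.2 fun i _ => Nat.cast_ne_zero.2 (Nat.factorial_ne_zero _)
    simp [fwdDiffPow_self, this]
  · by_cases hle : ∀ i, α i ≤ γ i
    · have hlt : ∑ i, α i < ∑ i, γ i := by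
        refine lt_of_le_of_ne (Finset.sum_le_sum fun i _ => hle i) fun heq => hγ ?_
        ext i
        exact ((Finset.sum_eq_sum_iff_of_le fun i _ => hle i).1 heq i (Finset.mem_univ i)).symm
      rw [zero_pow (by omega), mul_zero]
    · push Not at hle
      obtain ⟨i, hi⟩ := hle
      rw [Finset.prod_eq_zero (Finset.mem_univ i) (fwdDiffPow_of_lt 𝕜 hi), zero_div, zero_mul]

theorem continuous_dividedFwdDiff {𝕜 σ : Type*} [RCLike 𝕜] [Fintype σ] (α : σ → ℕ)
    (F : MvPolynomial σ 𝕜) : Continuous fun h : 𝕜 => dividedFwdDiff α h F := by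
  simp only [dividedFwdDiff, Module.Basis.constr_apply, Finsupp.sum]
  fun_prop

theorem pow_mul_dividedFwdDiff {𝕜 σ : Type*} [Field 𝕜] [CharZero 𝕜] [Fintype σ] [DecidableEq σ]
    (α : σ → ℕ) (h : 𝕜) (F : MvPolynomial σ 𝕜) :
    h ^ (∑ i, α i) * (∏ i, ((α i).factorial : 𝕜)) * dividedFwdDiff α h F =
      ∑ β ∈ Fintype.piFinset fun i => Finset.range (α i + 1),
        (∏ i, ((-1) ^ (α i - β i) * (α i).choose (β i) : 𝕜)) * eval (fun i => h * β i) F := by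
  have hfac : (∏ i, ((α i).factorial : 𝕜)) ≠ 0 :=
    Finset.prod_ne_zero_iff.2 fun i _ => Nat.cast_ne_zero.2 (Nat.factorial_ne_zero _)
  suffices h : (h ^ (∑ i, α i) * (∏ i, ((α i).factorial : 𝕜))) • dividedFwdDiff α h =
      ∑ β ∈ Fintype.piFinset fun i => Finset.range (α i + 1),
        (∏ i, ((-1) ^ (α i - β i) * (α i).choose (β i) : 𝕜)) •
          (aeval (R := 𝕜) fun i => h * β i).toLinearMap by
    simpa [coe_aeval_eq_eval] using DFunLike.congr_fun h F
  refine (basisMonomials σ 𝕜).ext fun γ => ?_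
  have hmom : ∑ β ∈ Fintype.piFinset fun i => Finset.range (α i + 1),
      (∏ i, ((-1) ^ (α i - β i) * (α i).choose (β i) : 𝕜)) * ∏ i, (h * β i) ^ γ i =
      h ^ (∑ i, γ i) * ∏ i, fwdDiffPow 𝕜 (α i) (γ i) := by
    simp only [fwdDiffPow, Finset.prod_univ_sum, ← Finset.prod_pow_eq_pow_sum,
      Finset.mul_sum, ← Finset.prod_mul_distrib]
    refine Finset.sum_congr rfl fun β _ => Finset.prod_congr rfl fun i _ => ?_
    ring
  simp only [coe_basisMonomials, LinearMap.smul_apply, dividedFwdDiff_monomial, smul_eq_mul,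
    LinearMap.sum_apply, AlgHom.toLinearMap_apply, aeval_monomial, map_one, one_mul,
    Finsupp.prod_fintype _ _ fun _ => pow_zero _, hmom]
  by_cases hle : ∀ i, α i ≤ γ i
  · have hadd : ∑ i, γ i = ∑ i, α i + (∑ i, γ i - ∑ i, α i) :=
      (Nat.add_sub_cancel' (Finset.sum_le_sum fun i _ => hle i)).symm
    conv_rhs => rw [hadd, pow_add]
    field_simp
  · push Not at hle
    obtain ⟨i, hi⟩ := hle
    have hzero : ∏ i, fwdDiffPow 𝕜 (α i) (γ i) = 0 :=
      Finset.prod_eq_zero (Finset.mem_univ i) (fwdDiffPow_of_lt 𝕜 hi)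
    simp [hzero]

/-- Evaluations on the grid `h • D p`, composed with algebra maps `Ψ p` centred at distinct points,
are unisolvent on `V` for small `h ≠ 0` as soon as the coefficients of `Ψ p f` with exponents in
the lower sets `D p` are. -/
theorem exists_unisolvent_grid {𝕜 K σ τ : Type*} [RCLike 𝕜] [Finite K] [Finite σ]
    (ξ : K → τ → 𝕜) (hξ : Function.Injective ξ)
    (Ψ : K → MvPolynomial τ 𝕜 →ₐ[𝕜] MvPolynomial σ 𝕜)
    (hΨ : ∀ p i, constantCoeff (Ψ p (X i)) = ξ p i)
    (D : K → Finset (σ → ℕ)) (hD : ∀ p, ∀ α ∈ D p, ∀ β : σ → ℕ, (∀ i, β i ≤ α i) → β ∈ D p)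
    (hsurj : ∀ p F, ∃ f, ∀ α ∈ D p, coeff (Finsupp.equivFunOnFinite.symm α) (Ψ p f) =
      coeff (Finsupp.equivFunOnFinite.symm α) F)
    (V : Submodule 𝕜 (MvPolynomial τ 𝕜))
    (hV : ∀ f, ∃! g, g ∈ V ∧ ∀ p, ∀ α ∈ D p,
      coeff (Finsupp.equivFunOnFinite.symm α) (Ψ p g) =
        coeff (Finsupp.equivFunOnFinite.symm α) (Ψ p f)) :
    ∃ η : ℝ, 0 < η ∧ ∀ h : 𝕜, 0 < ‖h‖ → ‖h‖ < η → ∀ f, ∃! g, g ∈ V ∧ ∀ p, ∀ α ∈ D p,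
      eval (fun i => h * α i) (Ψ p g) = eval (fun i => h * α i) (Ψ p f) := by
  classical
  have := Fintype.ofFinite σ
  let T : MvPolynomial τ 𝕜 →ₗ[𝕜] ((Σ p, D p) → 𝕜) := LinearMap.pi fun q =>
    lcoeff 𝕜 (Finsupp.equivFunOnFinite.symm q.2.1) ∘ₗ (Ψ q.1).toLinearMap
  let S : 𝕜 → MvPolynomial τ 𝕜 →ₗ[𝕜] ((Σ p, D p) → 𝕜) := fun h => LinearMap.pi fun q =>
    (aeval (R := 𝕜) fun i => h * (q.2.1 i : 𝕜)).toLinearMap ∘ₗ (Ψ q.1).toLinearMap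
  let P : 𝕜 → MvPolynomial τ 𝕜 →ₗ[𝕜] ((Σ p, D p) → 𝕜) := fun h => LinearMap.pi fun q =>
    dividedFwdDiff q.2.1 h ∘ₗ (Ψ q.1).toLinearMap
  have hS : ∀ h f g, S h g = S h f ↔ ∀ p, ∀ α ∈ D p,
      eval (fun i => h * (α i : 𝕜)) (Ψ p g) = eval (fun i => h * (α i : 𝕜)) (Ψ p f) := by
    intro h f g
    simp [S, funext_iff, Sigma.forall]
  have hT : ∀ f g, T g = T f ↔ ∀ p, ∀ α ∈ D p,
      coeff (Finsupp.equivFunOnFinite.symm α) (Ψ p g) =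
        coeff (Finsupp.equivFunOnFinite.symm α) (Ψ p f) := by
    intro f g
    simp [T, funext_iff, Sigma.forall]
  simp only [← hS]
  simp only [← hT] at hV
  refine exists_unisolvent_of_continuous_perturbation V T ?_ hV S P ?_ ?_ ?_
  · intro y
    choose f hf using fun p => hsurj p
      (∑ α : D p, monomial (Finsupp.equivFunOnFinite.symm α.1) (y ⟨p, α⟩))
    obtain ⟨N, hN⟩ := (Set.finite_range fun q : Σ p, D p =>
      (Finsupp.equivFunOnFinite.symm q.2.1).degree).bddAbove
    obtain ⟨g, hg⟩ := exists_coeff_eq_of_pairwise_ne ξ hξ Ψ hΨ (N + 1) f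
    refine ⟨g, funext fun ⟨p, α⟩ => ?_⟩
    have h1 := hg p (Finsupp.equivFunOnFinite.symm α.1)
      (Nat.lt_succ_of_le (hN ⟨⟨p, α⟩, rfl⟩))
    have h2 := hf p α α.2
    change coeff _ (Ψ p g) = _
    rw [h1, h2]
    simp [coeff_sum, coeff_monomial]
  · exact fun g => continuous_pi fun q => continuous_dividedFwdDiff _ _
  · ext1 f
    simp only [P, T, dividedFwdDiff_zero]
  · intro h hh g hg
    have hg0 := (hS h 0 g).1 (by simpa using hg)
    ext ⟨p, α⟩
    have key := (pow_mul_dividedFwdDiff α.1 h (Ψ p g)).trans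
      (Finset.sum_eq_zero fun β hβ => ?_)
    · have hfac : (∏ i, ((α.1 i).factorial : 𝕜)) ≠ 0 :=
        Finset.prod_ne_zero_iff.2 fun i _ => Nat.cast_ne_zero.2 (Nat.factorial_ne_zero _)
      exact (mul_eq_zero.1 key).resolve_left (mul_ne_zero (pow_ne_zero _ hh) hfac)
    · rw [hg0 p β (hD p α α.2 β fun i => ?_)]
      · simp
      · exact Nat.lt_succ_iff.1 (Finset.mem_range.1 (Fintype.mem_piFinset.1 hβ i))

theorem coeff_pderiv_pow {R σ : Type*} [CommRing R] (i : σ) (n : ℕ) (F : MvPolynomial σ R)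
    (m : σ →₀ ℕ) :
    coeff m (((pderiv i).toLinearMap ^ n : Module.End R (MvPolynomial σ R)) F) =
      coeff (m + Finsupp.single i n) F * ((m i + 1).ascFactorial n : R) := by
  induction n generalizing F with
  | zero => simp
  | succ n ih =>
    rw [pow_succ, Module.End.mul_apply, ih]
    change coeff _ (pderiv i F) * _ = _
    rw [coeff_pderiv, add_assoc, ← Finsupp.single_add, Nat.ascFactorial_succ]
    simp only [Finsupp.add_apply, Finsupp.single_eq_same]
    push_cast
    ring

theorem coeff_list_prod_pderiv_pow {R σ : Type*} [CommRing R] (α : σ → ℕ) (F : MvPolynomial σ R)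
    (l : List σ) (hl : l.Nodup) (m : σ →₀ ℕ) (hm : ∀ i ∈ l, m i = 0) :
    coeff m ((l.map fun i =>
      ((pderiv i).toLinearMap ^ α i : Module.End R (MvPolynomial σ R))).prod F) =
      coeff (m + (l.map fun i => Finsupp.single i (α i)).sum) F *
        (l.map fun i => ((α i).factorial : R)).prod := by
  classical
  induction l generalizing m with
  | nil => simp
  | cons i l ih =>
    rw [List.nodup_cons] at hl
    rw [List.map_cons, List.prod_cons, Module.End.mul_apply, coeff_pderiv_pow, ih hl.2,
      hm i List.mem_cons_self, zero_add, Nat.one_ascFactorial, List.map_cons, List.sum_cons,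
      List.map_cons, List.prod_cons, add_assoc]
    · ring
    · intro j hj
      have hij : j ≠ i := fun h => hl.1 (h ▸ hj)
      simp [hm j (List.mem_cons_of_mem _ hj), Finsupp.single_eq_of_ne hij]

theorem constantCoeff_DMulti {𝕜 : Type*} [RCLike 𝕜] {d : ℕ} (α : Fin d → ℕ)
    (F : MvPolynomial (Fin d) 𝕜) :
    constantCoeff (DMulti α F) =
      coeff (Finsupp.equivFunOnFinite.symm α) F * ∏ i, ((α i).factorial : 𝕜) := by
  have h := coeff_list_prod_pderiv_pow α F (List.finRange d) (List.nodup_finRange d) 0 (by simp)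
  rw [← List.ofFn_eq_map, ← List.ofFn_eq_map, ← List.ofFn_eq_map, List.sum_ofFn, List.prod_ofFn,
    zero_add] at h
  have hα : ∑ i, Finsupp.single i (α i) = Finsupp.equivFunOnFinite.symm α := by
    ext j
    simp [Finsupp.finsetSum_apply, Finsupp.single_apply]
  rw [hα] at h
  exact h

/-- The affine change of variables `f ↦ f (ξ + ∑ i, ρ i * X i)`. -/
noncomputable def affineSubst {𝕜 : Type*} [RCLike 𝕜] {d : ℕ} (ξ : Fin d → 𝕜)
    (ρ : Fin d → Fin d → 𝕜) : MvPolynomial (Fin d) 𝕜 →ₐ[𝕜] MvPolynomial (Fin d) 𝕜 :=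
  aeval fun j => C (ξ j) + ∑ i, C (ρ i j) * X i

theorem constantCoeff_affineSubst {𝕜 : Type*} [RCLike 𝕜] {d : ℕ} (ξ : Fin d → 𝕜)
    (ρ : Fin d → Fin d → 𝕜) (f : MvPolynomial (Fin d) 𝕜) :
    constantCoeff (affineSubst ξ ρ f) = eval ξ f := by
  have : constantCoeff.comp (affineSubst ξ ρ).toRingHom = eval ξ :=
    MvPolynomial.ringHom_ext (fun c => by simp) fun i => by simp [affineSubst]
  exact DFunLike.congr_fun this f

theorem affineSubst_dirDeriv {𝕜 : Type*} [RCLike 𝕜] {d : ℕ} (ξ : Fin d → 𝕜)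
    (ρ : Fin d → Fin d → 𝕜) (i : Fin d) (f : MvPolynomial (Fin d) 𝕜) :
    affineSubst ξ ρ (dirDeriv (ρ i) f) = pderiv i (affineSubst ξ ρ f) := by
  simp only [dirDeriv, LinearMap.sum_apply, LinearMap.smul_apply]
  change affineSubst ξ ρ (∑ j, ρ i j • pderiv j f) = _
  induction f using MvPolynomial.induction_on with
  | C c => simp [affineSubst]
  | add p q hp hq => simp only [map_add, smul_add, Finset.sum_add_distrib, hp, hq]
  | mul_X p j hp =>
    have hX : pderiv i (affineSubst ξ ρ (X j)) = C (ρ i j) := by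
      simp [affineSubst, Derivation.leibniz, pderiv_X, Pi.single_apply]
    simp only [Derivation.leibniz, map_mul, smul_add, Finset.sum_add_distrib, map_add, hX, ← hp,
      smul_eq_mul, pderiv_X]
    simp [Pi.single_apply, Finset.mul_sum, smul_eq_C_mul, mul_comm, affineSubst, mul_left_comm]

theorem affineSubst_dirDerivMulti {𝕜 : Type*} [RCLike 𝕜] {d : ℕ} (ξ : Fin d → 𝕜)
    (ρ : Fin d → Fin d → 𝕜) (α : Fin d → ℕ) (f : MvPolynomial (Fin d) 𝕜) :
    affineSubst ξ ρ (dirDerivMulti ρ α f) = DMulti α (affineSubst ξ ρ f) := by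
  have hpow : ∀ i n f, affineSubst ξ ρ ((dirDeriv (ρ i) ^ n) f) =
      ((pderiv i).toLinearMap ^ n : Module.End 𝕜 (MvPolynomial (Fin d) 𝕜))
        (affineSubst ξ ρ f) := by
    intro i n
    induction n with
    | zero => simp
    | succ n ih =>
      intro f
      rw [pow_succ, pow_succ, Module.End.mul_apply, ih, affineSubst_dirDeriv]
      rfl
  rw [dirDerivMulti, DMulti, List.ofFn_eq_map, List.ofFn_eq_map]
  induction List.finRange d with
  | nil => simp
  | cons i l ih => simp only [List.map_cons, List.prod_cons, Module.End.mul_apply, hpow, ih]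

theorem eval_dirDerivMulti {𝕜 : Type*} [RCLike 𝕜] {d : ℕ} (ξ : Fin d → 𝕜)
    (ρ : Fin d → Fin d → 𝕜) (α : Fin d → ℕ) (f : MvPolynomial (Fin d) 𝕜) :
    eval ξ (dirDerivMulti ρ α f) =
      coeff (Finsupp.equivFunOnFinite.symm α) (affineSubst ξ ρ f) *
        ∏ i, ((α i).factorial : 𝕜) := by
  rw [← constantCoeff_affineSubst ξ ρ, affineSubst_dirDerivMulti, constantCoeff_DMulti]

theorem affineSubst_surjective {𝕜 : Type*} [RCLike 𝕜] {d : ℕ} (ξ : Fin d → 𝕜)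
    {ρ : Fin d → Fin d → 𝕜} (hρ : LinearIndependent 𝕜 ρ) :
    Function.Surjective (affineSubst ξ ρ) := by
  rw [← AlgHom.range_eq_top, eq_top_iff, ← adjoin_range_X, Algebra.adjoin_le_iff]
  rintro _ ⟨i, rfl⟩
  have hunit : IsUnit (Matrix.of ρ) := Matrix.linearIndependent_rows_iff_isUnit.1 hρ
  obtain ⟨B, hB⟩ := hunit.exists_right_inv
  refine ⟨∑ j, C (B j i) * (X j - C (ξ j)), ?_⟩
  have hentry : ∀ k, ∑ j, ρ k j * B j i = if k = i then 1 else 0 := fun k => by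
    have := congrFun (congrFun hB k) i
    simpa [Matrix.mul_apply, Matrix.one_apply] using this
  have hX : ∀ j, affineSubst ξ ρ (C (B j i) * (X j - C (ξ j))) =
      ∑ k, C (ρ k j * B j i) * X k := fun j => by
    simp only [affineSubst, map_mul, map_sub, aeval_X, algHom_C, algebraMap_eq, add_sub_cancel_left,
      Finset.mul_sum]
    exact Finset.sum_congr rfl fun k _ => by ring
  change affineSubst ξ ρ _ = _
  rw [map_sum, Finset.sum_congr rfl fun j _ => hX j, Finset.sum_comm]
  simp_rw [← Finset.sum_mul, ← map_sum, hentry]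
  simp

theorem dirDerivMulti_single {𝕜 : Type*} [RCLike 𝕜] {d : ℕ} (α : Fin d → ℕ) :
    dirDerivMulti (fun i => Pi.single i (1 : 𝕜)) α = DMulti α := by
  have h : ∀ i : Fin d, dirDeriv (Pi.single i (1 : 𝕜)) = (pderiv i).toLinearMap := fun i => by
    rw [dirDeriv, Finset.sum_eq_single i]
    · simp
    · intro j _ hj
      simp [hj]
    · simp
  simp only [dirDerivMulti, DMulti, h]

theorem eval_DMulti {𝕜 : Type*} [RCLike 𝕜] {d : ℕ} (ξ : Fin d → 𝕜) (α : Fin d → ℕ)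
    (f : MvPolynomial (Fin d) 𝕜) :
    eval ξ (DMulti α f) = coeff (Finsupp.equivFunOnFinite.symm α)
      (affineSubst ξ (fun i => Pi.single i 1) f) * ∏ i, ((α i).factorial : 𝕜) := by
  rw [← dirDerivMulti_single, eval_dirDerivMulti]

theorem polyD_eq_constr {𝕜 : Type*} [RCLike 𝕜] {d : ℕ} (q : MvPolynomial (Fin d) 𝕜) :
    polyD q = (basisMonomials (Fin d) 𝕜).constr 𝕜 (fun β => DMulti (𝕜 := 𝕜) fun i => β i) q := by
  rw [Module.Basis.constr_apply]
  rfl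

theorem polyD_prod_X_pow {𝕜 : Type*} [RCLike 𝕜] {d : ℕ} (β : Fin d → ℕ) :
    polyD (∏ i, X i ^ β i : MvPolynomial (Fin d) 𝕜) = DMulti β := by
  have h : (∏ i, X i ^ β i : MvPolynomial (Fin d) 𝕜) =
      basisMonomials (Fin d) 𝕜 (Finsupp.equivFunOnFinite.symm β) := by
    rw [coe_basisMonomials]
    beta_reduce
    rw [monomial_eq, Finsupp.prod_fintype _ _ fun _ => pow_zero _]
    simp
  rw [polyD_eq_constr, h, Module.Basis.constr_basis]
  simp

theorem eval_polyD_qpoly {𝕜 : Type*} [RCLike 𝕜] {d : ℕ} (n : ℕ) (a : ℕ → ℕ)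
    (c : Fin d → ℕ → 𝕜) (m : ℕ) (ξ : Fin d → 𝕜) (f : MvPolynomial (Fin d) 𝕜) :
    eval ξ (polyD (qpoly d n a c m) f) =
      ∑ γ ∈ (Fintype.piFinset fun _ : Fin d =>
          Fintype.piFinset fun _ : Fin (n + 1) => Finset.range (m + 1)).filter
        (fun γ => ∑ j : Fin (n + 1), a j.1 * ∑ i, γ i j = m),
      ((∏ i, ∏ j, c i j.1 ^ γ i j) / ((∏ i, ∏ j, Nat.factorial (γ i j) : ℕ) : 𝕜)) *
        (coeff (Finsupp.equivFunOnFinite.symm fun i => ∑ j, γ i j)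
          (affineSubst ξ (fun i => Pi.single i 1) f) *
            ∏ i, ((∑ j, γ i j).factorial : 𝕜)) := by
  rw [polyD_eq_constr, qpoly, map_sum, LinearMap.sum_apply, map_sum]
  refine Finset.sum_congr rfl fun γ _ => ?_
  rw [map_smul, ← polyD_eq_constr, polyD_prod_X_pow, LinearMap.smul_apply, smul_eval, eval_DMulti]

/-- Substitution of the curve `φ(t) = ξ + ∑ j, c j * t ^ a j`, the parameter being the
variable `X i₀`. -/
noncomputable def curveSubst {𝕜 : Type*} [RCLike 𝕜] {d : ℕ} (i₀ : Fin d) (n : ℕ) (a : ℕ → ℕ)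
    (c : Fin d → ℕ → 𝕜) (ξ : Fin d → 𝕜) : MvPolynomial (Fin d) 𝕜 →ₐ[𝕜] MvPolynomial (Fin d) 𝕜 :=
  aeval fun i => C (ξ i) + ∑ j : Fin (n + 1), C (c i j) * X i₀ ^ a j

theorem coeff_curveSubst_zero_monomial {𝕜 : Type*} [RCLike 𝕜] {d : ℕ} (i₀ : Fin d) (n : ℕ)
    (a : ℕ → ℕ) (ha : ∀ j ≤ n, 1 ≤ a j) (c : Fin d → ℕ → 𝕜) (m : ℕ) (β : Fin d →₀ ℕ) :
    coeff (Finsupp.single i₀ m) (curveSubst i₀ n a c 0 (monomial β 1)) =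
      ∑ γ ∈ (Fintype.piFinset fun _ : Fin d =>
          Fintype.piFinset fun _ : Fin (n + 1) => Finset.range (m + 1)).filter
        (fun γ => ∑ j : Fin (n + 1), a j.1 * ∑ i, γ i j = m),
      ((∏ i, ∏ j, c i j.1 ^ γ i j) / ((∏ i, ∏ j, Nat.factorial (γ i j) : ℕ) : 𝕜)) *
        (coeff (Finsupp.equivFunOnFinite.symm fun i => ∑ j, γ i j) (monomial β (1 : 𝕜)) *
            ∏ i, ((∑ j, γ i j).factorial : 𝕜)) := by
  have hexp : curveSubst i₀ n a c 0 (monomial β 1) =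
      ∑ γ ∈ Fintype.piFinset fun i => Finset.piAntidiag (Finset.univ : Finset (Fin (n + 1))) (β i),
        monomial (Finsupp.single i₀ (∑ j : Fin (n + 1), a j.1 * ∑ i, γ i j))
          ((∏ i, (Nat.multinomial Finset.univ (γ i) : 𝕜)) * ∏ i, ∏ j, c i j.1 ^ γ i j) := by
    rw [curveSubst, aeval_monomial, Finsupp.prod_fintype _ _ fun _ => pow_zero _]
    simp only [map_one, one_mul, Pi.zero_apply, C_0, zero_add, Finset.sum_pow_eq_sum_piAntidiag,
      Finset.prod_univ_sum]
    refine Finset.sum_congr rfl fun γ _ => ?_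
    have hexpo : ∑ j : Fin (n + 1), a j.1 * ∑ i, γ i j = ∑ i, ∑ j : Fin (n + 1), a j.1 * γ i j := by
      simp_rw [Finset.mul_sum]
      exact Finset.sum_comm
    rw [← C_mul_X_pow_eq_monomial, hexpo]
    simp only [Finset.prod_mul_distrib, mul_pow, map_mul, map_prod, map_pow, map_natCast,
      ← pow_mul, Finset.prod_pow_eq_pow_sum, mul_assoc]
  have hset : ((Fintype.piFinset fun i =>
        Finset.piAntidiag (Finset.univ : Finset (Fin (n + 1))) (β i)).filter
          fun γ => ∑ j : Fin (n + 1), a j.1 * ∑ i, γ i j = m) =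
      ((Fintype.piFinset fun _ : Fin d =>
          Fintype.piFinset fun _ : Fin (n + 1) => Finset.range (m + 1)).filter
        (fun γ => ∑ j : Fin (n + 1), a j.1 * ∑ i, γ i j = m)).filter
        fun γ => β = Finsupp.equivFunOnFinite.symm fun i => ∑ j, γ i j := by
    ext γ
    simp only [Finset.mem_filter, Fintype.mem_piFinset, Finset.mem_piAntidiag, Finset.mem_univ,
      implies_true, and_true, Finset.mem_range, Finsupp.ext_iff,
      Finsupp.equivFunOnFinite_symm_apply_apply, Nat.lt_succ_iff]
    constructor
    · rintro ⟨h1, h2⟩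
      refine ⟨⟨fun i j => ?_, h2⟩, fun i => (h1 i).symm⟩
      calc γ i j ≤ ∑ i, γ i j :=
          Finset.single_le_sum (f := fun i => γ i j) (fun _ _ => Nat.zero_le _) (Finset.mem_univ i)
        _ ≤ a j.1 * ∑ i, γ i j := Nat.le_mul_of_pos_left _ (ha j (Nat.lt_succ_iff.1 j.2))
        _ ≤ ∑ j : Fin (n + 1), a j.1 * ∑ i, γ i j :=
          Finset.single_le_sum (f := fun j : Fin (n + 1) => a j.1 * ∑ i, γ i j)
            (fun _ _ => Nat.zero_le _) (Finset.mem_univ j)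
        _ = m := h2
    · rintro ⟨⟨-, h2⟩, h3⟩
      exact ⟨fun i => (h3 i).symm, h2⟩
  have hsingle : ∀ p, Finsupp.single i₀ p = Finsupp.single i₀ m ↔ p = m := fun p =>
    (Finsupp.single_injective i₀).eq_iff
  simp only [hexp, coeff_sum, coeff_monomial, hsingle]
  rw [← Finset.sum_filter, hset, Finset.sum_filter]
  refine Finset.sum_congr rfl fun γ _ => ?_
  split_ifs with hβ
  · have hspec : ∀ i, ((∑ j, γ i j).factorial : 𝕜) =
        (∏ j, ((γ i j).factorial : 𝕜)) * (Nat.multinomial Finset.univ (γ i) : 𝕜) := fun i => by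
      rw [← Nat.multinomial_spec]
      push_cast
      rfl
    have hne : (∏ i, ∏ j, ((γ i j).factorial : 𝕜)) ≠ 0 :=
      Finset.prod_ne_zero_iff.2 fun i _ => Finset.prod_ne_zero_iff.2 fun j _ =>
        Nat.cast_ne_zero.2 (Nat.factorial_ne_zero _)
    simp only [hspec, Finset.prod_mul_distrib]
    push_cast
    field_simp
  · simp

theorem coeff_curveSubst {𝕜 : Type*} [RCLike 𝕜] {d : ℕ} (i₀ : Fin d) (n : ℕ)
    (a : ℕ → ℕ) (ha : ∀ j ≤ n, 1 ≤ a j) (c : Fin d → ℕ → 𝕜) (ξ : Fin d → 𝕜) (m : ℕ)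
    (f : MvPolynomial (Fin d) 𝕜) :
    coeff (Finsupp.single i₀ m) (curveSubst i₀ n a c ξ f) =
      eval ξ (polyD (qpoly d n a c m) f) := by
  rw [eval_polyD_qpoly]
  have hcomp : curveSubst i₀ n a c ξ f =
      curveSubst i₀ n a c 0 (affineSubst ξ (fun i => Pi.single i 1) f) := by
    have : curveSubst i₀ n a c ξ =
        (curveSubst i₀ n a c 0).comp (affineSubst ξ fun i => Pi.single i 1) :=
      MvPolynomial.algHom_ext fun i => by
        simp [curveSubst, affineSubst, Pi.single_apply, apply_ite]
    exact DFunLike.congr_fun this f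
  rw [hcomp]
  set G := affineSubst ξ (fun i => Pi.single i 1) f
  have hlin := (basisMonomials (Fin d) 𝕜).ext
    (f₁ := lcoeff 𝕜 (Finsupp.single i₀ m) ∘ₗ (curveSubst i₀ n a c 0).toLinearMap)
    (f₂ := ∑ γ ∈ (Fintype.piFinset fun _ : Fin d =>
          Fintype.piFinset fun _ : Fin (n + 1) => Finset.range (m + 1)).filter
        (fun γ => ∑ j : Fin (n + 1), a j.1 * ∑ i, γ i j = m),
      ((∏ i, ∏ j, c i j.1 ^ γ i j) / ((∏ i, ∏ j, Nat.factorial (γ i j) : ℕ) : 𝕜)) •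
        (∏ i, ((∑ j, γ i j).factorial : 𝕜)) •
          lcoeff 𝕜 (Finsupp.equivFunOnFinite.symm fun i => ∑ j, γ i j))
    fun β => by
      have h := coeff_curveSubst_zero_monomial i₀ n a ha c m β
      simpa [mul_comm] using h
  simpa [mul_comm] using DFunLike.congr_fun hlin G

theorem exists_coeff_curveSubst {𝕜 : Type*} [RCLike 𝕜] {d : ℕ} (i₀ : Fin d) (n : ℕ)
    (a : ℕ → ℕ) (ha0 : a 0 = 1) (ha : ∀ j, 1 ≤ j → j ≤ n → 2 ≤ a j) (c : Fin d → ℕ → 𝕜)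
    (hc : ∃ i, c i 0 ≠ 0) (ξ : Fin d → 𝕜) (F : MvPolynomial (Fin d) 𝕜) (N : ℕ) :
    ∃ f, ∀ m < N, coeff (Finsupp.single i₀ m) (curveSubst i₀ n a c ξ f) =
      coeff (Finsupp.single i₀ m) F := by
  obtain ⟨i, hi⟩ := hc
  let R : MvPolynomial (Fin d) 𝕜 :=
    C (c i 0) + ∑ j : Fin n, C (c i (j + 1)) * X i₀ ^ (a (j + 1) - 1)
  have hR0 : constantCoeff R = c i 0 := by
    simp only [R, map_add, map_sum, map_mul, map_pow, constantCoeff_C, constantCoeff_X]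
    rw [Finset.sum_eq_zero, add_zero]
    intro j _
    have := ha (j + 1) (by omega) (by omega)
    rw [zero_pow (by omega), mul_zero]
  have hu : curveSubst i₀ n a c ξ (X i - C (ξ i)) = X i₀ * R := by
    simp only [curveSubst, map_sub, aeval_X, algHom_C, algebraMap_eq, add_sub_cancel_left,
      Fin.sum_univ_succ, Fin.val_zero, Fin.val_succ, ha0, pow_one, R, mul_add, Finset.mul_sum]
    congr 1
    · ring
    · refine Finset.sum_congr rfl fun j _ => ?_
      have := ha (j + 1) (by omega) (by omega)
      obtain ⟨k, hk⟩ : ∃ k, a (j + 1) = k + 1 := ⟨a (j + 1) - 1, by omega⟩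
      rw [hk, Nat.add_sub_cancel]
      ring
  have hcoeff : ∀ m k, m ≤ k → coeff (Finsupp.single i₀ m)
      (curveSubst i₀ n a c ξ ((X i - C (ξ i)) ^ k)) = if m = k then c i 0 ^ k else 0 := by
    intro m k hmk
    rw [map_pow, hu, mul_pow, X_pow_eq_monomial, coeff_monomial_mul']
    by_cases h : m = k
    · subst h
      simp only [le_refl, if_true, tsub_self, one_mul]
      rw [← constantCoeff_eq, map_pow, hR0]
    · rw [if_neg h, if_neg]
      intro hle
      have := hle i₀
      simp only [Finsupp.single_eq_same] at this
      omega
  induction N with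
  | zero => exact ⟨0, by simp⟩
  | succ N ih =>
    obtain ⟨f, hf⟩ := ih
    refine ⟨f + C ((coeff (Finsupp.single i₀ N) F -
      coeff (Finsupp.single i₀ N) (curveSubst i₀ n a c ξ f)) / c i 0 ^ N) *
        (X i - C (ξ i)) ^ N, fun m hm => ?_⟩
    rw [map_add, map_mul, algHom_C, algebraMap_eq, coeff_add, coeff_C_mul,
      hcoeff m N (Nat.lt_succ_iff.1 hm)]
    split_ifs with h
    · subst h
      field_simp
      ring
    · rw [hf m (by omega)]
      simp

theorem eval_affineSubst {𝕜 : Type*} [RCLike 𝕜] {d : ℕ} (ξ : Fin d → 𝕜)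
    (ρ : Fin d → Fin d → 𝕜) (h : 𝕜) (α : Fin d → ℕ) (f : MvPolynomial (Fin d) 𝕜) :
    eval (fun i => h * α i) (affineSubst ξ ρ f) =
      eval (fun j => ξ j + h * ∑ i, (α i : 𝕜) * ρ i j) f := by
  have : (eval fun i => h * (α i : 𝕜)).comp (affineSubst ξ ρ).toRingHom =
      eval fun j => ξ j + h * ∑ i, (α i : 𝕜) * ρ i j := by
    refine MvPolynomial.ringHom_ext (fun c => by simp) fun j => ?_
    simp only [affineSubst, AlgHom.toRingHom_eq_coe, RingHom.comp_apply, RingHom.coe_coe, aeval_X,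
      map_add, map_sum, map_mul, eval_C, eval_X, Finset.mul_sum]
    exact congrArg _ (Finset.sum_congr rfl fun i _ => by ring)
  exact DFunLike.congr_fun this f

theorem eval_curveSubst {𝕜 : Type*} [RCLike 𝕜] {d : ℕ} (i₀ : Fin d) (n : ℕ) (a : ℕ → ℕ)
    (c : Fin d → ℕ → 𝕜) (ξ : Fin d → 𝕜) (x : Fin d → 𝕜) (f : MvPolynomial (Fin d) 𝕜) :
    eval x (curveSubst i₀ n a c ξ f) =
      eval (fun i => ξ i + ∑ j ∈ Finset.range (n + 1), c i j * x i₀ ^ a j) f := by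
  have : (eval x).comp (curveSubst i₀ n a c ξ).toRingHom =
      eval fun i => ξ i + ∑ j ∈ Finset.range (n + 1), c i j * x i₀ ^ a j :=
    MvPolynomial.ringHom_ext (fun c => by simp) fun i => by
      simp [curveSubst, Finset.sum_range]
  exact DFunLike.congr_fun this f

/-- if the Hermite-type interpolation problem given by the functionals
`f ↦ (D_{ρ^{(k)}}^α f)(ξ^{(k)})` (`1 ≤ k ≤ μ`, `α ∈ Δ^{(k)}`) and
`f ↦ (q^{(l)}_{n(l),m}(D) f)(ξ^{(μ+l)})` (`1 ≤ l ≤ ν`, `0 ≤ m ≤ a_1^{(l)}`) is uniquely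
solvable from the finite-dimensional subspace `V`, then for all sufficiently small
`h ≠ 0` the Lagrange interpolation problem at the perturbed points
`ξ^{(k)} + h ∑_i α_i ρ_i^{(k)}` and `ξ^{(μ+l)} + φ^{(l)}(mh)` is uniquely solvable
from `V`. -/
theorem perturbed_lagrange_unisolvent {𝕜 : Type*} [RCLike 𝕜] (d μ ν : ℕ) (hd : 1 ≤ d)
    (ξ : Fin (μ + ν) → (Fin d → 𝕜)) (hξ : Function.Injective ξ)
    (Δ : Fin μ → Finset (Fin d → ℕ))
    (hΔ : ∀ k, ∀ α ∈ Δ k, ∀ β : Fin d → ℕ, (∀ i, β i ≤ α i) → β ∈ Δ k)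
    (ρ : Fin μ → Fin d → (Fin d → 𝕜)) (hρ : ∀ k, LinearIndependent 𝕜 (ρ k))
    (nl : Fin ν → ℕ) (hnl : ∀ l, 1 ≤ nl l)
    (a : Fin ν → ℕ → ℕ) (ha0 : ∀ l, a l 0 = 1)
    (hadec : ∀ l j, 1 ≤ j → j < nl l → a l (j + 1) < a l j)
    (han : ∀ l, 2 ≤ a l (nl l))
    (c : Fin ν → Fin d → ℕ → 𝕜) (hc : ∀ l, ∃ i, c l i 0 ≠ 0)
    (V : Submodule 𝕜 (MvPolynomial (Fin d) 𝕜)) (hV : FiniteDimensional 𝕜 V)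
    (hHermite : ∀ f : MvPolynomial (Fin d) 𝕜, ∃! g : MvPolynomial (Fin d) 𝕜,
      g ∈ V ∧
      (∀ k : Fin μ, ∀ α ∈ Δ k,
        eval (ξ (Fin.castAdd ν k)) (dirDerivMulti (ρ k) α g)
          = eval (ξ (Fin.castAdd ν k)) (dirDerivMulti (ρ k) α f)) ∧
      (∀ l : Fin ν, ∀ m ≤ a l 1,
        eval (ξ (Fin.natAdd μ l)) (polyD (qpoly d (nl l) (a l) (c l) m) g)
          = eval (ξ (Fin.natAdd μ l)) (polyD (qpoly d (nl l) (a l) (c l) m) f))) :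
    ∃ η : ℝ, 0 < η ∧ ∀ h : 𝕜, 0 < ‖h‖ → ‖h‖ < η →
      ∀ f : MvPolynomial (Fin d) 𝕜, ∃! g : MvPolynomial (Fin d) 𝕜,
        g ∈ V ∧
        (∀ k : Fin μ, ∀ α ∈ Δ k,
          eval (fun j => ξ (Fin.castAdd ν k) j + h * ∑ i, (α i : 𝕜) * ρ k i j) g
            = eval (fun j => ξ (Fin.castAdd ν k) j + h * ∑ i, (α i : 𝕜) * ρ k i j) f) ∧
        (∀ l : Fin ν, ∀ m ≤ a l 1,
          eval (fun i => ξ (Fin.natAdd μ l) i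
              + ∑ j ∈ Finset.range (nl l + 1), c l i j * ((m : 𝕜) * h) ^ a l j) g
            = eval (fun i => ξ (Fin.natAdd μ l) i
              + ∑ j ∈ Finset.range (nl l + 1), c l i j * ((m : 𝕜) * h) ^ a l j) f) := by
  classical
  let i₀ : Fin d := ⟨0, hd⟩
  have ha : ∀ l j, 1 ≤ j → j ≤ nl l → 2 ≤ a l j := by
    intro l j hj hjn
    induction hjn using Nat.decreasingInduction with
    | self => exact han l
    | of_succ j hlt ih => exact (ih (by omega)).trans (hadec l j hj hlt).le
  have ha1 : ∀ l, ∀ j ≤ nl l, 1 ≤ a l j := by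
    intro l j hjn
    rcases Nat.eq_zero_or_pos j with rfl | hj
    · exact (ha0 l).ge
    · exact (ha l j hj hjn).trans' one_le_two
  let Ψ : Fin μ ⊕ Fin ν → MvPolynomial (Fin d) 𝕜 →ₐ[𝕜] MvPolynomial (Fin d) 𝕜 :=
    Sum.elim (fun k => affineSubst (ξ (Fin.castAdd ν k)) (ρ k))
      fun l => curveSubst i₀ (nl l) (a l) (c l) (ξ (Fin.natAdd μ l))
  let D : Fin μ ⊕ Fin ν → Finset (Fin d → ℕ) :=
    Sum.elim Δ fun l => (Finset.range (a l 1 + 1)).image fun m => Pi.single i₀ m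
  have hsingle : ∀ m : ℕ, Finsupp.equivFunOnFinite.symm (Pi.single i₀ m : Fin d → ℕ) = Finsupp.single i₀ m :=
    fun m => Finsupp.equivFunOnFinite_symm_single i₀ m
  have hcoeff : ∀ f g, (∀ p, ∀ α ∈ D p,
      coeff (Finsupp.equivFunOnFinite.symm α) (Ψ p g) =
        coeff (Finsupp.equivFunOnFinite.symm α) (Ψ p f)) ↔
      (∀ k : Fin μ, ∀ α ∈ Δ k,
        eval (ξ (Fin.castAdd ν k)) (dirDerivMulti (ρ k) α g)
          = eval (ξ (Fin.castAdd ν k)) (dirDerivMulti (ρ k) α f)) ∧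
      (∀ l : Fin ν, ∀ m ≤ a l 1,
        eval (ξ (Fin.natAdd μ l)) (polyD (qpoly d (nl l) (a l) (c l) m) g)
          = eval (ξ (Fin.natAdd μ l)) (polyD (qpoly d (nl l) (a l) (c l) m) f)) := by
    intro f g
    have hfac : ∀ α : Fin d → ℕ, (∏ i, ((α i).factorial : 𝕜)) ≠ 0 := fun α =>
      Finset.prod_ne_zero_iff.2 fun i _ => Nat.cast_ne_zero.2 (Nat.factorial_ne_zero _)
    simp only [Sum.forall, Ψ, D, Sum.elim_inl, Sum.elim_inr, Finset.forall_mem_image,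
      Finset.mem_range, Nat.lt_succ_iff, hsingle, coeff_curveSubst i₀ _ _ (ha1 _),
      eval_dirDerivMulti, mul_left_inj' (hfac _)]
  have heval : ∀ (h : 𝕜) (f g), (∀ p, ∀ α ∈ D p,
      eval (fun i => h * α i) (Ψ p g) = eval (fun i => h * α i) (Ψ p f)) ↔
      (∀ k : Fin μ, ∀ α ∈ Δ k,
          eval (fun j => ξ (Fin.castAdd ν k) j + h * ∑ i, (α i : 𝕜) * ρ k i j) g
            = eval (fun j => ξ (Fin.castAdd ν k) j + h * ∑ i, (α i : 𝕜) * ρ k i j) f) ∧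
        (∀ l : Fin ν, ∀ m ≤ a l 1,
          eval (fun i => ξ (Fin.natAdd μ l) i
              + ∑ j ∈ Finset.range (nl l + 1), c l i j * ((m : 𝕜) * h) ^ a l j) g
            = eval (fun i => ξ (Fin.natAdd μ l) i
              + ∑ j ∈ Finset.range (nl l + 1), c l i j * ((m : 𝕜) * h) ^ a l j) f) := by
    intro h f g
    simp only [Sum.forall, Ψ, D, Sum.elim_inl, Sum.elim_inr, Finset.forall_mem_image,
      Finset.mem_range, Nat.lt_succ_iff, eval_affineSubst, eval_curveSubst, Pi.single_eq_same]
    simp only [mul_comm h (Nat.cast _)]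
  have hmain := exists_unisolvent_grid (ξ ∘ finSumFinEquiv) (hξ.comp finSumFinEquiv.injective)
    Ψ ?_ D ?_ ?_ V ?_
  · simpa only [heval] using hmain
  · rintro (k | l) i
    · simp [Ψ, affineSubst]
    · have hzero : ∀ j : Fin (nl l + 1), a l j ≠ 0 := fun j =>
        Nat.one_le_iff_ne_zero.1 (ha1 l j (Nat.lt_succ_iff.1 j.2))
      simp [Ψ, curveSubst, hzero]
  · rintro (k | l) α hα β hβ
    · exact hΔ k α hα β hβ
    · obtain ⟨m, hm, rfl⟩ := Finset.mem_image.1 hα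
      refine Finset.mem_image.2 ⟨β i₀, ?_, ?_⟩
      · have := hβ i₀
        rw [Pi.single_eq_same] at this
        exact Finset.mem_range.2 (this.trans_lt (Finset.mem_range.1 hm))
      · ext i
        by_cases hi : i = i₀
        · subst hi; simp
        · have := hβ i
          rw [Pi.single_eq_of_ne hi] at this ⊢
          omega
  · rintro (k | l) F
    · obtain ⟨f, rfl⟩ := affineSubst_surjective (ξ (Fin.castAdd ν k)) (hρ k) F
      exact ⟨f, fun _ _ => rfl⟩
    · obtain ⟨f, hf⟩ := exists_coeff_curveSubst i₀ (nl l) (a l) (ha0 l) (ha l) (c l) (hc l)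
        (ξ (Fin.natAdd μ l)) F (a l 1 + 1)
      refine ⟨f, Finset.forall_mem_image.2 fun m hm => ?_⟩
      rw [hsingle]
      exact hf m (Finset.mem_range.1 hm)
  · simpa only [hcoeff] using hHermite
end
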